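/- arXiv:2501.16919 — 12 statements merged into one kernel-verified Lean document; each statement's English description precedes it below -/
import Mathlib

section
/- Under the adaptive Online Conditional Gradient algorithm run for T rounds on the cost functions f̂_1, …, f̂_T, for every comparator x* ∈ 𝒳 the regret satisfies Σ_{t=1}^T (f̂_t(x_t) − f̂_t(x*)) ≤ 38 · D · L_T · T^{3/4} · √(log(T·e·L_T/L_1)) · (1 + (1/(304·√T)) · max_{1 ≤ t ≤ T} (L_t/L_{t−1})). -/
open scoped RealInnerProductSpace

/-- The regularized linear cost `⟪G, y⟫ + c‖y - p‖²`. -/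
noncomputable def regCost {E : Type*} [NormedAddCommGroup E] [InnerProductSpace ℝ E]
    (G p : E) (c : ℝ) (y : E) : ℝ :=
  ⟪G, y⟫ + c * ‖y - p‖ ^ 2

section RegCost

variable {E : Type*} [NormedAddCommGroup E] [InnerProductSpace ℝ E]

theorem regCost_segment (G p : E) (c s : ℝ) (a b : E) :
    regCost G p c ((1 - s) • a + s • b) =
      regCost G p c a + s * ⟪G + (2 * c) • (a - p), b - a⟫ + c * s ^ 2 * ‖b - a‖ ^ 2 := by
  have h : (1 - s) • a + s • b = a + s • (b - a) := by
    rw [sub_smul, one_smul, smul_sub]; abel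
  have h' : a + s • (b - a) - p = (a - p) + s • (b - a) := by abel
  unfold regCost
  rw [h, h', norm_add_sq_real, inner_add_right, inner_add_left, inner_smul_right,
    inner_smul_right, real_inner_smul_left, norm_smul, mul_pow, Real.norm_eq_abs, sq_abs]
  ring

/-- Quadratic growth of the regularized cost around a constrained minimizer. -/
theorem regCost_quadratic_growth {X : Set E} (hX : Convex ℝ X) {G p z y : E} {c : ℝ}
    (hc : 0 ≤ c) (hz : z ∈ X) (hmin : ∀ w ∈ X, regCost G p c z ≤ regCost G p c w) (hy : y ∈ X) :
    regCost G p c z + c * ‖y - z‖ ^ 2 ≤ regCost G p c y := by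
  have hone : regCost G p c y =
      regCost G p c z + ⟪G + (2 * c) • (z - p), y - z⟫ + c * ‖y - z‖ ^ 2 := by
    have := regCost_segment G p c 1 z y
    simpa using this
  suffices h : 0 ≤ ⟪G + (2 * c) • (z - p), y - z⟫ by linarith
  have key : ∀ s : ℝ, 0 < s → s ≤ 1 →
      0 ≤ ⟪G + (2 * c) • (z - p), y - z⟫ + s * (c * ‖y - z‖ ^ 2) := by
    intro s hs hs1
    have hmem : (1 - s) • z + s • y ∈ X := hX hz hy (by linarith) hs.le (by ring)
    have h1 := hmin _ hmem
    rw [regCost_segment] at h1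
    have h2 : 0 ≤ s * (⟪G + (2 * c) • (z - p), y - z⟫ + s * (c * ‖y - z‖ ^ 2)) := by linarith
    exact nonneg_of_mul_nonneg_right h2 hs
  have hB : 0 ≤ c * ‖y - z‖ ^ 2 := by positivity
  generalize ⟪G + (2 * c) • (z - p), y - z⟫ = A at key ⊢
  generalize c * ‖y - z‖ ^ 2 = B at key hB
  by_contra! hA
  have hpos : 0 < B - A := by linarith
  have h3 := key (-A / (2 * (B - A))) (by apply div_pos <;> linarith)
    (by rw [div_le_one (by linarith)]; linarith)
  have h4 : -A / (2 * (B - A)) * B ≤ -A / 2 := by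
    rw [div_mul_eq_mul_div, div_le_iff₀ (by linarith)]
    nlinarith [mul_pos (neg_pos.mpr hA) (neg_pos.mpr hA)]
  linarith

/-- Progress of one conditional gradient step with step size `s`. -/
theorem regCost_conditionalGradient_step {G p a v z : E} {c s D : ℝ}
    (hc : 0 ≤ c) (hs : 0 ≤ s) (hva : ‖v - a‖ ≤ D)
    (hv : ⟪G + (2 * c) • (a - p), v⟫ ≤ ⟪G + (2 * c) • (a - p), z⟫) :
    regCost G p c ((1 - s) • a + s • v) - regCost G p c z ≤
      (1 - s) * (regCost G p c a - regCost G p c z) + c * s ^ 2 * D ^ 2 := by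
  have hz : regCost G p c z =
      regCost G p c a + ⟪G + (2 * c) • (a - p), z - a⟫ + c * ‖z - a‖ ^ 2 := by
    have := regCost_segment G p c 1 a z
    simpa using this
  rw [regCost_segment]
  have h1 : c * s ^ 2 * ‖v - a‖ ^ 2 ≤ c * s ^ 2 * D ^ 2 := by gcongr
  have h2 : ⟪G + (2 * c) • (a - p), v - a⟫ ≤ regCost G p c z - regCost G p c a := by
    have : 0 ≤ c * ‖z - a‖ ^ 2 := by positivity
    rw [inner_sub_right] at hz ⊢
    linarith
  have h3 := mul_le_mul_of_nonneg_left h2 hs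
  linarith

/-- How the suboptimality gap changes when a new linear cost is added and the regularization
is increased. -/
theorem regCost_gap_update {G p g y z z' : E} {c c' D : ℝ} (hcc : c ≤ c') (hyp : ‖y - p‖ ≤ D)
    (hz : regCost G p c z ≤ regCost G p c z') :
    regCost (G + g) p c' y - regCost (G + g) p c' z' ≤
      (regCost G p c y - regCost G p c z) + ‖g‖ * ‖y - z'‖ + (c' - c) * D ^ 2 := by
  have h1 : ⟪g, y⟫ - ⟪g, z'⟫ ≤ ‖g‖ * ‖y - z'‖ := by
    rw [← inner_sub_right]; exact real_inner_le_norm _ _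
  have h2 : (c' - c) * ‖y - p‖ ^ 2 ≤ (c' - c) * D ^ 2 := by
    have : 0 ≤ c' - c := by linarith
    gcongr
  have h3 : 0 ≤ (c' - c) * ‖z' - p‖ ^ 2 := mul_nonneg (by linarith) (sq_nonneg _)
  unfold regCost at *
  rw [inner_add_left, inner_add_left]
  linarith

theorem exists_forall_regCost_le {X : Set E} (hX : IsCompact X) (hne : X.Nonempty)
    (G p : E) (c : ℝ) : ∃ z ∈ X, ∀ w ∈ X, regCost G p c z ≤ regCost G p c w := by
  have hcont : ContinuousOn (regCost G p c) X := by
    unfold regCost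
    fun_prop
  obtain ⟨z, hz, hmin⟩ := hX.exists_isMinOn hne hcont
  exact ⟨z, hz, fun w hw => hmin hw⟩

/-- The be-the-leader inequality with an increasing regularization. -/
theorem sum_inner_le_regCost {T : ℕ} {X : Set E} {p : E} {g z : ℕ → E} {c : ℕ → ℝ}
    (hc : ∀ t ∈ Finset.Icc 1 T, 0 ≤ c t)
    (hcmono : ∀ t, 1 ≤ t → t + 1 ≤ T → c t ≤ c (t + 1))
    (hz : ∀ t, z t ∈ X)
    (hmin : ∀ t, ∀ w ∈ X, regCost (∑ τ ∈ Finset.Icc 1 t, g τ) p (c t) (z t) ≤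
      regCost (∑ τ ∈ Finset.Icc 1 t, g τ) p (c t) w) (k : ℕ) (hk : k + 1 ≤ T) :
    ∑ t ∈ Finset.Icc 1 (k + 1), ⟪g t, z t⟫ ≤
      regCost (∑ τ ∈ Finset.Icc 1 (k + 1), g τ) p (c (k + 1)) (z (k + 1)) := by
  induction k with
  | zero =>
    have := mul_nonneg (hc 1 (by simp [hk])) (sq_nonneg ‖z 1 - p‖)
    simp [regCost, this]
  | succ k ih =>
    have h1 := ih (by omega)
    have h2 := hmin (k + 1) _ (hz (k + 1 + 1))
    have h3 := mul_nonneg (sub_nonneg.2 (hcmono (k + 1) (by omega) hk))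
      (sq_nonneg ‖z (k + 1 + 1) - p‖)
    rw [Finset.sum_Icc_succ_top (b := k + 1) (by omega),
      Finset.sum_Icc_succ_top (b := k + 1) (by omega)]
    unfold regCost at *
    rw [inner_add_left]
    linarith

end RegCost

/-- Summing a contractive recursion whose per-round perturbations are `4 / t`, `1 / (8T)` and
the logarithmic increments of `L`. -/
theorem sum_le_of_gap_recursion {T : ℕ} (hT : 1 ≤ T) {u d σ L : ℕ → ℝ} {W : ℝ}
    (hW : 0 < W) (hW2 : W ^ 2 = T * Real.sqrt T)
    (hu1 : u 1 ≤ 1) (hdu : ∀ t ∈ Finset.Icc 1 T, d t ^ 2 ≤ u t)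
    (hσ : ∀ t : ℕ, σ t = min 1 (2 / Real.sqrt t))
    (hL : ∀ t ∈ Finset.Icc 1 T, 0 < L t) (hL1T : L 1 ≤ L T)
    (hrec : ∀ t, 1 ≤ t → t + 1 ≤ T → u (t + 1) ≤
      (1 - σ t) * u t + σ t ^ 2 + d (t + 1) / (2 * W) + (1 - L t / L (t + 1))) :
    ∑ t ∈ Finset.Icc 1 T, u t ≤
      12 * Real.sqrt T * (1 + Real.log T + Real.log (L T / L 1)) := by
  have hT' : (1 : ℝ) ≤ T := by exact_mod_cast hT
  have hS1 : 1 ≤ Real.sqrt T := Real.one_le_sqrt.2 hT'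
  have hSS : Real.sqrt T * Real.sqrt T = T := Real.mul_self_sqrt (by positivity)
  set S := Real.sqrt T with hS
  have hS0 : 0 < S := by linarith
  have hs1 : 1 / S ≤ 1 := by rw [div_le_one hS0]; exact hS1
  have hu0 : ∀ t ∈ Finset.Icc 1 T, 0 ≤ u t := fun t ht => (sq_nonneg _).trans (hdu t ht)
  have main : ∀ k, k + 1 ≤ T →
      (1 - 1 / S) * u (k + 1) + 1 / (2 * S) * ∑ t ∈ Finset.Icc 1 (k + 1), u t ≤
        1 + 4 * (harmonic k : ℝ) + k / (8 * T) + (Real.log (L (k + 1)) - Real.log (L 1)) := by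
    intro k
    induction k with
    | zero =>
      intro _
      have h1 : 0 ≤ 1 / (2 * S) * u 1 :=
        mul_nonneg (by positivity) (hu0 1 (by simp [hT]))
      have h2 : 1 / S * u 1 = 2 * (1 / (2 * S) * u 1) := by field_simp
      simp
      simp only [one_div] at h1 h2
      simp only [mul_inv] at h1 h2 ⊢
      linarith
    | succ k ih =>
      intro hk
      have ih' := ih (by omega)
      have hr := hrec (k + 1) (by omega) hk
      have hmem : k + 1 ∈ Finset.Icc 1 T := by simp; omega
      have hmem' : k + 1 + 1 ∈ Finset.Icc 1 T := by simp; omega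
      have hσge : 1 / S ≤ σ (k + 1) := by
        rw [hσ]
        refine le_min hs1 ?_
        have hk0 : 0 < Real.sqrt ((k + 1 : ℕ) : ℝ) := Real.sqrt_pos.2 (by positivity)
        have hkS : Real.sqrt ((k + 1 : ℕ) : ℝ) ≤ S :=
          Real.sqrt_le_sqrt (by exact_mod_cast (by omega : k + 1 ≤ T))
        rw [div_le_div_iff₀ hS0 hk0]
        linarith
      have hσsq : σ (k + 1) ^ 2 ≤ 4 * ((k + 1 : ℕ) : ℝ)⁻¹ := by
        have h1 : σ (k + 1) ≤ 2 / Real.sqrt ((k + 1 : ℕ) : ℝ) := by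
          rw [hσ]; exact min_le_right _ _
        have h0 : 0 ≤ σ (k + 1) := le_trans (by positivity) hσge
        calc σ (k + 1) ^ 2 ≤ (2 / Real.sqrt ((k + 1 : ℕ) : ℝ)) ^ 2 := by gcongr
          _ = 4 * ((k + 1 : ℕ) : ℝ)⁻¹ := by
            rw [div_pow, Real.sq_sqrt (by positivity)]; ring
      have hlog : 1 - L (k + 1) / L (k + 1 + 1) ≤
          Real.log (L (k + 1 + 1)) - Real.log (L (k + 1)) := by
        have h := Real.one_sub_inv_le_log_of_pos
          (div_pos (hL _ hmem') (hL _ hmem))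
        rw [inv_div, Real.log_div (hL _ hmem').ne' (hL _ hmem).ne'] at h
        exact h
      have hd : d (k + 1 + 1) / (2 * W) ≤ 1 / (2 * S) * u (k + 1 + 1) + 1 / (8 * T) := by
        have h1 := hdu _ hmem'
        have h2 : 1 / (2 * S) * d (k + 1 + 1) ^ 2 ≤ 1 / (2 * S) * u (k + 1 + 1) := by gcongr
        have h3 : (1 / (2 * S)) * d (k + 1 + 1) ^ 2 + 1 / (8 * T) - d (k + 1 + 1) / (2 * W) =
            1 / (2 * S) * (d (k + 1 + 1) - S / (2 * W)) ^ 2 := by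
          have hTW : (T : ℝ) = W ^ 2 / S := by rw [hW2]; field_simp
          rw [hTW]
          field_simp
          ring
        have h4 : 0 ≤ 1 / (2 * S) * (d (k + 1 + 1) - S / (2 * W)) ^ 2 := by positivity
        linarith
      have hmul : (1 - σ (k + 1)) * u (k + 1) ≤ (1 - 1 / S) * u (k + 1) :=
        mul_le_mul_of_nonneg_right (by linarith) (hu0 _ hmem)
      have hhalf : 1 / S * u (k + 1 + 1) = 2 * (1 / (2 * S) * u (k + 1 + 1)) := by field_simp
      rw [Finset.sum_Icc_succ_top (by omega), harmonic_succ]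
      have hcast : ((k + 1 : ℕ) : ℝ) / (8 * T) = k / (8 * T) + 1 / (8 * T) := by
        push_cast; ring
      rw [hcast]
      push_cast at hσsq ⊢
      linarith
  obtain ⟨k, rfl⟩ : ∃ k, T = k + 1 := ⟨T - 1, by omega⟩
  have hm := main k le_rfl
  have hlast : 0 ≤ (1 - 1 / S) * u (k + 1) :=
    mul_nonneg (by linarith) (hu0 _ (by simp))
  have hharm : (harmonic k : ℝ) ≤ 1 + Real.log ((k + 1 : ℕ) : ℝ) := by
    refine le_trans ?_ (harmonic_le_one_add_log (k + 1))
    rw [harmonic_succ]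
    push_cast
    have : (0 : ℝ) ≤ ((k : ℝ) + 1)⁻¹ := by positivity
    linarith
  have hk8 : (k : ℝ) / (8 * ((k + 1 : ℕ) : ℝ)) ≤ 1 := by
    rw [div_le_one (by positivity)]
    push_cast
    have : (0 : ℝ) ≤ k := by positivity
    linarith
  have hlogT : 0 ≤ Real.log ((k + 1 : ℕ) : ℝ) := Real.log_nonneg hT'
  have hLmono : Real.log (L (k + 1)) - Real.log (L 1) = Real.log (L (k + 1) / L 1) :=
    (Real.log_div (hL _ (by simp)).ne' (hL _ (by simp)).ne').symm
  have hlogL : 0 ≤ Real.log (L (k + 1) / L 1) :=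
    Real.log_nonneg ((one_le_div (hL _ (by simp))).2 hL1T)
  rw [hLmono] at hm
  have hfin : 1 / (2 * S) * ∑ t ∈ Finset.Icc 1 (k + 1), u t ≤
      6 * (1 + Real.log ((k + 1 : ℕ) : ℝ) + Real.log (L (k + 1) / L 1)) := by linarith
  calc ∑ t ∈ Finset.Icc 1 (k + 1), u t
      = 2 * S * (1 / (2 * S) * ∑ t ∈ Finset.Icc 1 (k + 1), u t) := by field_simp
    _ ≤ 2 * S * (6 * (1 + Real.log ((k + 1 : ℕ) : ℝ) + Real.log (L (k + 1) / L 1))) := by gcongr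
    _ = _ := by ring


open scoped RealInnerProductSpace

/-- **Adaptive Online Conditional Gradient regret bound.**
Under the adaptive OCG algorithm run for `T` rounds on cost functions `f̂_1, …, f̂_T`,
for every comparator `x* ∈ 𝒳` the regret satisfies
`Σ_{t=1}^T (f̂_t(x_t) − f̂_t(x*)) ≤ 38·D·L_T·T^{3/4}·√(log(T·e·L_T/L_1)) ·
  (1 + (1/(304·√T))·max_{1 ≤ t ≤ T} L_t/L_{t−1})`. -/
theorem adaptive_ocg_regret
    (n T : ℕ) (hT : 1 ≤ T)
    (𝒳 : Set (EuclideanSpace ℝ (Fin n))) (hclosed : IsClosed 𝒳) (hconvex : Convex ℝ 𝒳)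
    (D : ℝ) (hD : 0 < D) (hdiam : ∀ x ∈ 𝒳, ∀ y ∈ 𝒳, ‖x - y‖ ≤ D)
    (fhat : ℕ → EuclideanSpace ℝ (Fin n) → ℝ)
    (hfconv : ∀ t ∈ Finset.Icc 1 T, ConvexOn ℝ 𝒳 (fhat t))
    (x v g : ℕ → EuclideanSpace ℝ (Fin n))
    (hx1 : x 1 ∈ 𝒳)
    (hxmem : ∀ t ∈ Finset.Icc 1 T, x t ∈ 𝒳)
    -- g t is a subgradient of f̂_t at x_t
    (hsubgrad : ∀ t ∈ Finset.Icc 1 T, ∀ y ∈ 𝒳, fhat t (x t) + ⟪g t, y - x t⟫ ≤ fhat t y)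
    (L : ℕ → ℝ)
    (hLdef : ∀ t ∈ Finset.Icc 1 T, L t = ‖g t‖)
    (hL0 : L 0 = L 1) (hL1pos : 0 < L 1)
    (hLmono : ∀ t ∈ Finset.Icc 1 (T - 1), L t ≤ L (t + 1))
    (hLip : ∀ t ∈ Finset.Icc 1 T, ∀ y ∈ 𝒳, ∀ z ∈ 𝒳, |fhat t y - fhat t z| ≤ L t * ‖y - z‖)
    (η σ : ℕ → ℝ)
    (hη : ∀ t, η t = D / (2 * L t * (T : ℝ) ^ ((3 : ℝ) / 4)))
    (hσ : ∀ t, σ t = min 1 (2 / Real.sqrt t))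
    -- v t solves the linear optimization problem `min_{y ∈ 𝒳} ⟪∇F_t(x_t), y⟫`, where
    -- `∇F_t(x_t) = Σ_{τ=1}^t g_τ + (2/η_t)·(x_t − x_1)`
    (hv : ∀ t ∈ Finset.Icc 1 T, v t ∈ 𝒳 ∧ ∀ y ∈ 𝒳,
      ⟪(∑ τ ∈ Finset.Icc 1 t, g τ) + (2 / η t) • (x t - x 1), v t⟫ ≤
      ⟪(∑ τ ∈ Finset.Icc 1 t, g τ) + (2 / η t) • (x t - x 1), y⟫)
    (hupd : ∀ t ∈ Finset.Icc 1 T, x (t + 1) = (1 - σ t) • x t + σ t • v t) :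
    ∀ xstar ∈ 𝒳,
      ∑ t ∈ Finset.Icc 1 T, (fhat t (x t) - fhat t xstar) ≤
        38 * D * L T * (T : ℝ) ^ ((3 : ℝ) / 4) *
          Real.sqrt (Real.log ((T : ℝ) * Real.exp 1 * L T / L 1)) *
          (1 + 1 / (304 * Real.sqrt T) *
            ((Finset.Icc 1 T).sup' (Finset.nonempty_Icc.mpr hT) fun t => L t / L (t - 1))) := by
  intro xstar hxstar
  have hT' : (1 : ℝ) ≤ T := by exact_mod_cast hT
  set W : ℝ := (T : ℝ) ^ ((3 : ℝ) / 4) with hWdef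
  have hW : 0 < W := by positivity
  have hW1 : 1 ≤ W := Real.one_le_rpow hT' (by norm_num)
  have hW2 : W ^ 2 = T * Real.sqrt T := by
    rw [hWdef, ← Real.rpow_natCast, ← Real.rpow_mul (by positivity), Real.sqrt_eq_rpow]
    nth_rewrite 2 [← Real.rpow_one (T : ℝ)]
    rw [← Real.rpow_add (by positivity)]
    norm_num
  have hstep : ∀ t, 1 ≤ t → t + 1 ≤ T → L t ≤ L (t + 1) := fun t h1 h2 =>
    hLmono t (Finset.mem_Icc.2 ⟨h1, by omega⟩)
  have hL1le : ∀ k, k + 1 ≤ T → L 1 ≤ L (k + 1) := by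
    intro k
    induction k with
    | zero => intro _; exact le_rfl
    | succ k ih => exact fun hk => (ih (by omega)).trans (hstep _ (by omega) hk)
  have hLpos : ∀ t ∈ Finset.Icc 1 T, 0 < L t := by
    intro t ht
    obtain ⟨h1, h2⟩ := Finset.mem_Icc.1 ht
    obtain ⟨k, rfl⟩ : ∃ k, t = k + 1 := ⟨t - 1, by omega⟩
    exact hL1pos.trans_le (hL1le k h2)
  have hLT : ∀ k, k < T → L (T - k) ≤ L T := by
    intro k
    induction k with
    | zero => intro _; exact le_rfl
    | succ k ih =>
      intro hk
      have h := hstep (T - (k + 1)) (by omega) (by omega)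
      rw [show T - (k + 1) + 1 = T - k by omega] at h
      exact h.trans (ih (by omega))
  have hLle : ∀ t ∈ Finset.Icc 1 T, L t ≤ L T := by
    intro t ht
    obtain ⟨h1, h2⟩ := Finset.mem_Icc.1 ht
    have h := hLT (T - t) (by omega)
    rwa [show T - (T - t) = t by omega] at h
  have hTmem : T ∈ Finset.Icc 1 T := by simp [hT]
  have h1mem : 1 ∈ Finset.Icc 1 T := by simp [hT]
  have hLTpos := hLpos T hTmem
  have hcompact : IsCompact 𝒳 := Metric.isCompact_of_isClosed_isBounded hclosed
    (Metric.isBounded_iff.2 ⟨D, fun y hy z hz => by rw [dist_eq_norm]; exact hdiam y hy z hz⟩)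
  set c : ℕ → ℝ := fun t => 2 * L t * W / D with hc
  have hcpos : ∀ t ∈ Finset.Icc 1 T, 0 < c t := fun t ht => by
    have := hLpos t ht
    simp only [hc]
    positivity
  have hcmono : ∀ t, 1 ≤ t → t + 1 ≤ T → c t ≤ c (t + 1) := fun t h1 h2 => by
    have := hstep t h1 h2
    simp only [hc]
    gcongr
  have hηc : ∀ t, 2 / η t = 2 * c t := fun t => by
    rw [hη, hc]
    simp only [div_div_eq_mul_div]
    ring
  set G : ℕ → EuclideanSpace ℝ (Fin n) := fun t => ∑ τ ∈ Finset.Icc 1 t, g τ with hG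
  have hGsucc : ∀ t, G (t + 1) = G t + g (t + 1) := fun t =>
    Finset.sum_Icc_succ_top (by omega) _
  choose z hz hzmin using fun t =>
    exists_forall_regCost_le hcompact ⟨x 1, hx1⟩ (G t) (x 1) (c t)
  set h : ℕ → ℝ := fun t => regCost (G t) (x 1) (c t) (x t) - regCost (G t) (x 1) (c t) (z t)
    with hh
  have hgrowth : ∀ t ∈ Finset.Icc 1 T, c t * ‖x t - z t‖ ^ 2 ≤ h t := fun t ht => by
    have := regCost_quadratic_growth hconvex (hcpos t ht).le (hz t) (hzmin t) (hxmem t ht)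
    simp only [hh]
    linarith
  have hrec : ∀ t, 1 ≤ t → t + 1 ≤ T → h (t + 1) ≤
      (1 - σ t) * h t + c t * σ t ^ 2 * D ^ 2 + L (t + 1) * ‖x (t + 1) - z (t + 1)‖ +
        (c (t + 1) - c t) * D ^ 2 := by
    intro t h1 h2
    have ht : t ∈ Finset.Icc 1 T := Finset.mem_Icc.2 ⟨h1, by omega⟩
    have ht' : t + 1 ∈ Finset.Icc 1 T := Finset.mem_Icc.2 ⟨by omega, h2⟩
    have hσ0 : 0 ≤ σ t := by rw [hσ]; positivity
    obtain ⟨hvmem, hvopt⟩ := hv t ht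
    have hvz := hvopt (z t) (hz t)
    rw [hηc] at hvz
    have hcg := regCost_conditionalGradient_step (hcpos t ht).le hσ0
      (hdiam _ hvmem _ (hxmem t ht)) hvz
    rw [← hupd t ht] at hcg
    have hgap := regCost_gap_update (g := g (t + 1)) (hcmono t h1 h2)
      (hdiam _ (hxmem _ ht') _ hx1) (hzmin t _ (hz (t + 1)))
    rw [← hGsucc, ← hLdef _ ht'] at hgap
    simp only [hh]
    linarith
  set d : ℕ → ℝ := fun t => ‖x t - z t‖ / D with hd
  set u : ℕ → ℝ := fun t => h t / (c t * D ^ 2) with hu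
  have hdu : ∀ t ∈ Finset.Icc 1 T, d t ^ 2 ≤ u t := fun t ht => by
    have hct := hcpos t ht
    simp only [hu, hd]
    rw [le_div_iff₀ (by positivity), div_pow]
    have : ‖x t - z t‖ ^ 2 / D ^ 2 * (c t * D ^ 2) = c t * ‖x t - z t‖ ^ 2 := by field_simp
    rw [this]
    exact hgrowth t ht
  have hu1 : u 1 ≤ 1 := by
    have hct := hcpos 1 h1mem
    simp only [hu]
    rw [div_le_one (by positivity)]
    have h1 : h 1 ≤ L 1 * D := by
      have h2 : ⟪g 1, x 1⟫ - ⟪g 1, z 1⟫ ≤ L 1 * D := by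
        rw [← inner_sub_right, hLdef 1 h1mem]
        exact (real_inner_le_norm _ _).trans (by gcongr; exact hdiam _ hx1 _ (hz 1))
      have h3 : 0 ≤ c 1 * ‖z 1 - x 1‖ ^ 2 := by positivity
      simp only [hh, regCost, hG, Finset.Icc_self, Finset.sum_singleton, sub_self, norm_zero]
      linarith
    have h2 : c 1 * D ^ 2 = 2 * W * (L 1 * D) := by simp only [hc]; field_simp
    rw [h2]
    nlinarith [mul_pos hL1pos hD]
  have hurec : ∀ t, 1 ≤ t → t + 1 ≤ T → u (t + 1) ≤
      (1 - σ t) * u t + σ t ^ 2 + d (t + 1) / (2 * W) + (1 - L t / L (t + 1)) := by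
    intro t h1 h2
    have ht : t ∈ Finset.Icc 1 T := Finset.mem_Icc.2 ⟨h1, by omega⟩
    have ht' : t + 1 ∈ Finset.Icc 1 T := Finset.mem_Icc.2 ⟨by omega, h2⟩
    have hct := hcpos _ ht
    have hct' := hcpos _ ht'
    have hLt := hLpos _ ht
    have hLt' := hLpos _ ht'
    have hut : 0 ≤ u t := (sq_nonneg _).trans (hdu t ht)
    have hσ1 : σ t ≤ 1 := by rw [hσ]; exact min_le_left _ _
    have hht : h t = u t * (c t * D ^ 2) := by simp only [hu]; field_simp
    have h3 : ((1 - σ t) * u t + σ t ^ 2) * (c t * D ^ 2) ≤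
        ((1 - σ t) * u t + σ t ^ 2) * (c (t + 1) * D ^ 2) := by
      have : 0 ≤ (1 - σ t) * u t := mul_nonneg (by linarith) hut
      have := hcmono t h1 h2
      gcongr
    have h4 : d (t + 1) / (2 * W) * (c (t + 1) * D ^ 2) =
        L (t + 1) * ‖x (t + 1) - z (t + 1)‖ := by
      simp only [hd, hc]; field_simp
    have h5 : (1 - L t / L (t + 1)) * (c (t + 1) * D ^ 2) = (c (t + 1) - c t) * D ^ 2 := by
      simp only [hc]; field_simp
    have h6 := hrec t h1 h2
    rw [hht] at h6
    have h7 : u (t + 1) = h (t + 1) / (c (t + 1) * D ^ 2) := rfl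
    rw [h7, div_le_iff₀ (by positivity)]
    linarith
  have hsumu := sum_le_of_gap_recursion hT hW hW2 hu1 hdu hσ hLpos (hLle 1 h1mem) hurec
  set Λ : ℝ := 1 + Real.log T + Real.log (L T / L 1) with hΛ
  have hΛ1 : 1 ≤ Λ := by
    have h1 := Real.log_nonneg hT'
    have h2 := Real.log_nonneg ((one_le_div hL1pos).2 (hLle 1 h1mem))
    linarith
  have hΛlog : Real.log ((T : ℝ) * Real.exp 1 * L T / L 1) = Λ := by
    rw [mul_div_assoc, Real.log_mul (by positivity) (by positivity),
      Real.log_mul (by positivity) (by positivity), Real.log_exp]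
    ring
  rw [hΛlog]
  have hsumd : ∑ t ∈ Finset.Icc 1 T, d t ≤ 4 * W * Real.sqrt Λ := by
    refine (abs_le_of_sq_le_sq' ?_ (by positivity)).2
    have h1 := sq_sum_le_card_mul_sum_sq (s := Finset.Icc 1 T) (f := d)
    rw [Nat.card_Icc, Nat.add_sub_cancel] at h1
    calc (∑ t ∈ Finset.Icc 1 T, d t) ^ 2 ≤ T * ∑ t ∈ Finset.Icc 1 T, d t ^ 2 := h1
      _ ≤ T * ∑ t ∈ Finset.Icc 1 T, u t := by gcongr with t ht; exact hdu t ht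
      _ ≤ T * (12 * Real.sqrt T * Λ) := by gcongr
      _ = 12 * W ^ 2 * Λ := by rw [hW2]; ring
      _ ≤ 16 * W ^ 2 * Λ := by gcongr; norm_num
      _ = (4 * W * Real.sqrt Λ) ^ 2 := by
        rw [mul_pow, mul_pow, Real.sq_sqrt (by linarith)]; norm_num
  have hbtl : ∑ t ∈ Finset.Icc 1 T, ⟪g t, z t⟫ ≤ regCost (G T) (x 1) (c T) xstar := by
    obtain ⟨k, hk⟩ : ∃ k, T = k + 1 := ⟨T - 1, by omega⟩
    have h1 := sum_inner_le_regCost (fun t ht => (hcpos t ht).le) hcmono hz hzmin k hk.ge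
    rw [← hk] at h1
    exact h1.trans (hzmin T xstar hxstar)
  have hreg : regCost (G T) (x 1) (c T) xstar ≤
      ∑ t ∈ Finset.Icc 1 T, ⟪g t, xstar⟫ + 2 * (D * L T * W) := by
    have h1 : ‖xstar - x 1‖ ^ 2 ≤ D ^ 2 := by gcongr; exact hdiam _ hxstar _ hx1
    have h2 := mul_le_mul_of_nonneg_left h1 (hcpos T hTmem).le
    have h3 : c T * D ^ 2 = 2 * (D * L T * W) := by simp only [hc]; field_simp
    simp only [regCost, hG, sum_inner]
    linarith
  have hlin : ∑ t ∈ Finset.Icc 1 T, (fhat t (x t) - fhat t xstar) ≤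
      ∑ t ∈ Finset.Icc 1 T, (L T * D * d t + ⟪g t, z t⟫ - ⟪g t, xstar⟫) := by
    refine Finset.sum_le_sum fun t ht => ?_
    have h1 := hsubgrad t ht xstar hxstar
    have h2 : ⟪g t, x t⟫ - ⟪g t, z t⟫ ≤ L T * D * d t := by
      rw [← inner_sub_right]
      calc ⟪g t, x t - z t⟫ ≤ ‖g t‖ * ‖x t - z t‖ := real_inner_le_norm _ _
        _ ≤ L T * ‖x t - z t‖ := by
          rw [← hLdef t ht]
          exact mul_le_mul_of_nonneg_right (hLle t ht) (norm_nonneg _)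
        _ = L T * D * d t := by simp only [hd]; field_simp
    rw [inner_sub_right] at h1
    linarith
  have hsplit : ∑ t ∈ Finset.Icc 1 T, (L T * D * d t + ⟪g t, z t⟫ - ⟪g t, xstar⟫) =
      L T * D * ∑ t ∈ Finset.Icc 1 T, d t + ∑ t ∈ Finset.Icc 1 T, ⟪g t, z t⟫ -
        ∑ t ∈ Finset.Icc 1 T, ⟪g t, xstar⟫ := by
    rw [Finset.sum_sub_distrib, Finset.sum_add_distrib, Finset.mul_sum]
  have hsup : 0 ≤ (Finset.Icc 1 T).sup' (Finset.nonempty_Icc.mpr hT)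
      fun t => L t / L (t - 1) := by
    refine le_trans ?_ (Finset.le_sup' (fun t => L t / L (t - 1)) h1mem)
    simp only [Nat.sub_self, hL0]
    positivity
  have hsqrt : 1 ≤ Real.sqrt Λ := Real.one_le_sqrt.2 hΛ1
  have hP : 0 < D * L T * W := by positivity
  have hd' : L T * D * ∑ t ∈ Finset.Icc 1 T, d t ≤ L T * D * (4 * W * Real.sqrt Λ) := by gcongr
  have hPΛ : D * L T * W ≤ D * L T * W * Real.sqrt Λ := le_mul_of_one_le_right hP.le hsqrt
  calc ∑ t ∈ Finset.Icc 1 T, (fhat t (x t) - fhat t xstar)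
      ≤ 6 * (D * L T * W * Real.sqrt Λ) := by linarith
    _ ≤ 38 * D * L T * W * Real.sqrt Λ := by linarith
    _ ≤ _ := le_mul_of_one_le_right (by positivity)
      (le_add_of_nonneg_right (mul_nonneg (by positivity) hsup))
end

section
/- Under the adaptive Online Conditional Gradient algorithm, with the auxiliary FTRL sequence x*_{t+1} ∈ argmin_{x ∈ 𝒳} F_t(x), one has Σ_{t=1}^T L_t·‖x_t − x*_{t+1}‖ ≤ 12 · D · L_T · T^{3/4} · √(log(T·e·L_T/L_1)). -/
open scoped RealInnerProductSpace

/-- Quadratic growth of a regularized linear function around its minimizer over a convex set. -/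
lemma quadratic_growth_of_isMinOn {E : Type*} [NormedAddCommGroup E] [InnerProductSpace ℝ E]
    {s : Set E} (hs : Convex ℝ s) (G p : E) (c : ℝ) {y z : E} (hy : y ∈ s) (hz : z ∈ s)
    (hmin : ∀ w ∈ s, ⟪G, z⟫ + c * ‖z - p‖ ^ 2 ≤ ⟪G, w⟫ + c * ‖w - p‖ ^ 2) :
    c * ‖y - z‖ ^ 2 ≤ (⟪G, y⟫ + c * ‖y - p‖ ^ 2) - (⟪G, z⟫ + c * ‖z - p‖ ^ 2) := by
  have expand : ∀ r : ℝ, (⟪G, z + r • (y - z)⟫ + c * ‖z + r • (y - z) - p‖ ^ 2) -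
      (⟪G, z⟫ + c * ‖z - p‖ ^ 2) =
      r * (⟪G, y - z⟫ + 2 * c * ⟪z - p, y - z⟫) + r ^ 2 * (c * ‖y - z‖ ^ 2) := by
    intro r
    rw [show z + r • (y - z) - p = (z - p) + r • (y - z) by abel, norm_add_sq_real,
      inner_add_right, inner_smul_right, inner_smul_right, norm_smul, mul_pow, Real.norm_eq_abs,
      sq_abs]
    ring
  set B := ⟪G, y - z⟫ + 2 * c * ⟪z - p, y - z⟫ with hB
  set Q := c * ‖y - z‖ ^ 2 with hQ
  have hB0 : 0 ≤ B := by
    by_contra! hneg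
    have key : ∀ r : ℝ, 0 < r → r ≤ 1 → 0 ≤ B + r * Q := by
      intro r hr hr1
      have h1 := hmin _ (hs.add_smul_sub_mem hz hy ⟨hr.le, hr1⟩)
      have h2 := expand r
      have h3 : 0 ≤ r * (B + r * Q) := by nlinarith
      exact nonneg_of_mul_nonneg_right h3 hr
    have h1 : 0 < |Q| - B := by linarith [abs_nonneg Q]
    have h2 := key (-B / (2 * (|Q| - B))) (by apply div_pos <;> linarith)
      (by rw [div_le_one (by linarith)]; linarith [abs_nonneg Q])
    have h3 : -B / (2 * (|Q| - B)) * Q ≤ -B / 2 := by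
      rw [div_mul_eq_mul_div, div_le_div_iff₀ (by linarith) (by norm_num)]
      nlinarith [le_abs_self Q]
    linarith
  have h := expand 1
  rw [one_smul, add_sub_cancel] at h
  linarith

/-- Progress of one conditional gradient step on a regularized linear function. -/
lemma conditional_gradient_step {E : Type*} [NormedAddCommGroup E] [InnerProductSpace ℝ E]
    (G p : E) {c σ D : ℝ} (hc : 0 ≤ c) (hσ : 0 ≤ σ) {x v y : E} (hxv : ‖v - x‖ ≤ D)
    (hv : ⟪G + (2 * c) • (x - p), v⟫ ≤ ⟪G + (2 * c) • (x - p), y⟫) :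
    ⟪G, (1 - σ) • x + σ • v⟫ + c * ‖(1 - σ) • x + σ • v - p‖ ^ 2 ≤
      (1 - σ) * (⟪G, x⟫ + c * ‖x - p‖ ^ 2) + σ * (⟪G, y⟫ + c * ‖y - p‖ ^ 2) +
        σ ^ 2 * (c * D ^ 2) := by
  have h1 : ∀ w, ⟪G + (2 * c) • (x - p), w⟫ = ⟪G, w⟫ + 2 * c * ⟪x - p, w⟫ := by
    intro w
    rw [inner_add_left, real_inner_smul_left]
  have e1 : ‖(1 - σ) • x + σ • v - p‖ ^ 2 =
      ‖x - p‖ ^ 2 + 2 * (σ * (⟪x - p, v⟫ - ⟪x - p, x⟫)) + σ ^ 2 * ‖v - x‖ ^ 2 := by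
    rw [show (1 - σ) • x + σ • v - p = (x - p) + σ • (v - x) by
        rw [sub_smul, one_smul, smul_sub]; abel, norm_add_sq_real,
      inner_smul_right, norm_smul, mul_pow, Real.norm_eq_abs, sq_abs, inner_sub_right]
  have e2 : ‖y - p‖ ^ 2 =
      ‖x - p‖ ^ 2 + 2 * (⟪x - p, y⟫ - ⟪x - p, x⟫) + ‖y - x‖ ^ 2 := by
    rw [show y - p = (x - p) + (y - x) by abel, norm_add_sq_real, inner_sub_right]
  rw [h1, h1] at hv
  rw [inner_add_right, inner_smul_right, inner_smul_right, e1, e2]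
  have h2 : ‖v - x‖ ^ 2 ≤ D ^ 2 := pow_le_pow_left₀ (norm_nonneg _) hxv 2
  have h3 : σ ^ 2 * (c * ‖v - x‖ ^ 2) ≤ σ ^ 2 * (c * D ^ 2) := by gcongr
  have h4 := mul_le_mul_of_nonneg_left hv hσ
  have h5 : 0 ≤ σ * (c * ‖y - x‖ ^ 2) := by positivity
  linarith

/-- Dividing the gap recursion by the growing Lipschitz constants costs a telescoping logarithm. -/
lemma normalized_gap_step {a a' ℓ ℓ' m σ e : ℝ} (ha : 0 ≤ a) (hℓ : 0 < ℓ) (hℓ' : ℓ ≤ ℓ')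
    (hm : 0 < m) (hσ : σ ≤ 1)
    (h : a' * (ℓ' * m) ≤ (1 - σ) * (a * (ℓ * m)) + σ ^ 2 * (ℓ * m) + e * (ℓ' * m) +
      (ℓ' - ℓ) * m) :
    a' ≤ (1 - σ) * a + σ ^ 2 + e + (Real.log ℓ' - Real.log ℓ) := by
  have hp : 0 < ℓ' := hℓ.trans_le hℓ'
  have hlog : 1 - ℓ / ℓ' ≤ Real.log ℓ' - Real.log ℓ := by
    have := Real.one_sub_inv_le_log_of_pos (div_pos hp hℓ)
    rwa [inv_div, Real.log_div hp.ne' hℓ.ne'] at this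
  have h1 : (1 - ℓ / ℓ') * (ℓ' * m) = (ℓ' - ℓ) * m := by field_simp
  have h2 : 0 ≤ ((1 - σ) * a + σ ^ 2) * ((ℓ' - ℓ) * m) := by
    have : 0 ≤ 1 - σ := by linarith
    have : 0 ≤ ℓ' - ℓ := by linarith
    positivity
  have h3 : a' * (ℓ' * m) ≤ ((1 - σ) * a + σ ^ 2 + e + (1 - ℓ / ℓ')) * (ℓ' * m) := by linarith
  have h4 := le_of_mul_le_mul_right h3 (mul_pos hp hm)
  linarith

/-- The summed form of the normalized gap recursion. -/
lemma sum_gap_le {T : ℕ} {s b : ℝ} {a d σ ℓ : ℕ → ℝ}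
    (ha : ∀ t ∈ Finset.Icc 1 T, 0 ≤ a t) (h1 : a 1 ≤ d 1 / b)
    (hs : ∀ t ∈ Finset.Icc 1 T, s ≤ σ t)
    (hσ : ∀ t ∈ Finset.Icc 1 T, σ t ^ 2 ≤ 4 * ((t : ℝ))⁻¹)
    (hrec : ∀ t, 1 ≤ t → t + 1 ≤ T → a (t + 1) ≤ (1 - σ t) * a t + σ t ^ 2 + d (t + 1) / b +
      (Real.log (ℓ (t + 1)) - Real.log (ℓ t))) (N : ℕ) (hN : N + 1 ≤ T) :
    s * ∑ t ∈ Finset.Icc 1 N, a t + a (N + 1) ≤ (∑ t ∈ Finset.Icc 1 (N + 1), d t) / b +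
      4 * ∑ t ∈ Finset.Icc 1 N, ((t : ℝ))⁻¹ + (Real.log (ℓ (N + 1)) - Real.log (ℓ 1)) := by
  induction N with
  | zero => simpa using h1
  | succ N ih =>
    have ih := ih (by omega)
    have hmem : N + 1 ∈ Finset.Icc 1 T := Finset.mem_Icc.2 ⟨by omega, by omega⟩
    have hr := hrec (N + 1) (by omega) hN
    have hq := hσ _ hmem
    have hsa := mul_le_mul_of_nonneg_right (hs _ hmem) (ha _ hmem)
    rw [Finset.sum_Icc_succ_top (by omega : 1 ≤ N + 1),
      Finset.sum_Icc_succ_top (by omega : 1 ≤ N + 1 + 1),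
      Finset.sum_Icc_succ_top (by omega : 1 ≤ N + 1) (fun t : ℕ => ((t : ℝ))⁻¹), add_div]
    linarith

/-- **Term (C) bound for adaptive OCG.**
Under the adaptive Online Conditional Gradient algorithm, with the auxiliary FTRL sequence
`x*_{t+1} ∈ argmin_{x ∈ 𝒳} F_t(x)`, one has
`Σ_{t=1}^T L_t·‖x_t − x*_{t+1}‖ ≤ 12·D·L_T·T^{3/4}·√(log(T·e·L_T/L_1))`. -/
theorem adaptive_ocg_termC
    (n T : ℕ) (hT : 1 ≤ T)
    (𝒳 : Set (EuclideanSpace ℝ (Fin n))) (hclosed : IsClosed 𝒳) (hconvex : Convex ℝ 𝒳)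
    (D : ℝ) (hD : 0 < D) (hdiam : ∀ x ∈ 𝒳, ∀ y ∈ 𝒳, ‖x - y‖ ≤ D)
    (fhat : ℕ → EuclideanSpace ℝ (Fin n) → ℝ)
    (hfconv : ∀ t ∈ Finset.Icc 1 T, ConvexOn ℝ 𝒳 (fhat t))
    (x v g : ℕ → EuclideanSpace ℝ (Fin n))
    (hx1 : x 1 ∈ 𝒳)
    (hxmem : ∀ t ∈ Finset.Icc 1 T, x t ∈ 𝒳)
    (hsubgrad : ∀ t ∈ Finset.Icc 1 T, ∀ y ∈ 𝒳, fhat t (x t) + ⟪g t, y - x t⟫ ≤ fhat t y)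
    (L : ℕ → ℝ)
    (hLdef : ∀ t ∈ Finset.Icc 1 T, L t = ‖g t‖)
    (hL0 : L 0 = L 1) (hL1pos : 0 < L 1)
    (hLmono : ∀ t ∈ Finset.Icc 1 (T - 1), L t ≤ L (t + 1))
    (hLip : ∀ t ∈ Finset.Icc 1 T, ∀ y ∈ 𝒳, ∀ z ∈ 𝒳, |fhat t y - fhat t z| ≤ L t * ‖y - z‖)
    (η σ : ℕ → ℝ)
    (hη : ∀ t, η t = D / (2 * L t * (T : ℝ) ^ ((3 : ℝ) / 4)))
    (hσ : ∀ t, σ t = min 1 (2 / Real.sqrt t))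
    (hv : ∀ t ∈ Finset.Icc 1 T, v t ∈ 𝒳 ∧ ∀ y ∈ 𝒳,
      ⟪(∑ τ ∈ Finset.Icc 1 t, g τ) + (2 / η t) • (x t - x 1), v t⟫ ≤
      ⟪(∑ τ ∈ Finset.Icc 1 t, g τ) + (2 / η t) • (x t - x 1), y⟫)
    (hupd : ∀ t ∈ Finset.Icc 1 T, x (t + 1) = (1 - σ t) • x t + σ t • v t)
    -- the auxiliary FTRL sequence: `xs (t+1)` minimizes
    -- `F_t(y) = Σ_{τ=1}^t ⟪g_τ, y⟫ + ‖y − x_1‖²/η_t` over `𝒳`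
    (xs : ℕ → EuclideanSpace ℝ (Fin n))
    (hxs : ∀ t ∈ Finset.Icc 1 T, xs (t + 1) ∈ 𝒳 ∧ ∀ y ∈ 𝒳,
      (∑ τ ∈ Finset.Icc 1 t, ⟪g τ, xs (t + 1)⟫) + ‖xs (t + 1) - x 1‖ ^ 2 / η t ≤
      (∑ τ ∈ Finset.Icc 1 t, ⟪g τ, y⟫) + ‖y - x 1‖ ^ 2 / η t) :
    ∑ t ∈ Finset.Icc 1 T, L t * ‖x t - xs (t + 1)‖ ≤
      12 * D * L T * (T : ℝ) ^ ((3 : ℝ) / 4) *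
        Real.sqrt (Real.log ((T : ℝ) * Real.exp 1 * L T / L 1)) := by
  set P : ℝ := (T : ℝ) ^ ((3 : ℝ) / 4) with hP
  have hTR : (1 : ℝ) ≤ T := by exact_mod_cast hT
  have hT0 : (0 : ℝ) < T := by linarith
  have hPpos : 0 < P := Real.rpow_pos_of_pos hT0 _
  have hPsq : P ^ 2 = T * Real.sqrt T := by
    rw [hP, ← Real.rpow_natCast, ← Real.rpow_mul hT0.le, Real.sqrt_eq_rpow]
    nth_rewrite 2 [← Real.rpow_one (T : ℝ)]
    rw [← Real.rpow_add hT0]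
    norm_num
  have hstep : ∀ t, 1 ≤ t → t + 1 ≤ T → L t ≤ L (t + 1) := fun t h1 h2 =>
    hLmono t (Finset.mem_Icc.2 ⟨h1, by omega⟩)
  have hLpos : ∀ t, 1 ≤ t → t ≤ T → 0 < L t := by
    intro t ht
    induction t, ht using Nat.le_induction with
    | base => exact fun _ => hL1pos
    | succ t ht ih => exact fun h => (ih (by omega)).trans_le (hstep t ht h)
  have hLle : ∀ t, 1 ≤ t → t ≤ T → L t ≤ L T := by
    intro t ht htT
    induction htT using Nat.decreasingInduction with
    | self => exact le_rfl
    | of_succ k hk ih => exact (hstep k ht hk).trans (ih (by omega))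
  set c : ℕ → ℝ := fun t => 2 * L t * P / D with hc
  have hη1 : ∀ t, (η t)⁻¹ = c t := fun t => by rw [hη, inv_div]
  set F : ℕ → EuclideanSpace ℝ (Fin n) → ℝ :=
    fun t y => ⟪∑ τ ∈ Finset.Icc 1 t, g τ, y⟫ + c t * ‖y - x 1‖ ^ 2 with hF
  have hcpos : ∀ t, 1 ≤ t → t ≤ T → 0 < c t := fun t h1 h2 => by
    have := hLpos t h1 h2
    positivity
  have hxsF : ∀ t, 1 ≤ t → t ≤ T → xs (t + 1) ∈ 𝒳 ∧ ∀ y ∈ 𝒳, F t (xs (t + 1)) ≤ F t y := by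
    intro t h1 h2
    obtain ⟨hm, hmin⟩ := hxs t (Finset.mem_Icc.2 ⟨h1, h2⟩)
    refine ⟨hm, fun y hy => ?_⟩
    have := hmin y hy
    simp only [div_eq_mul_inv, hη1, ← sum_inner] at this
    simp only [hF]
    linarith
  set δ : ℕ → ℝ := fun t => ‖x t - xs (t + 1)‖ / D with hδ
  set h : ℕ → ℝ := fun t => F t (x t) - F t (xs (t + 1)) with hh
  set m : ℝ := 2 * P * D with hm
  have hmpos : 0 < m := by positivity
  have hcm : ∀ t, c t * D ^ 2 = L t * m := fun t => by
    simp only [hc, hm]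
    field_simp
  set a : ℕ → ℝ := fun t => h t / (L t * m) with ha
  have hah : ∀ t, 1 ≤ t → t ≤ T → a t * (L t * m) = h t := fun t h1 h2 =>
    div_mul_cancel₀ _ (mul_pos (hLpos t h1 h2) hmpos).ne'
  have hnorm : ∀ t, ‖x t - xs (t + 1)‖ = δ t * D := fun t => by
    simp only [hδ]
    field_simp
  have hda : ∀ t, 1 ≤ t → t ≤ T → δ t ^ 2 ≤ a t := by
    intro t h1 h2
    obtain ⟨hmem, hmin⟩ := hxsF t h1 h2
    have hg := quadratic_growth_of_isMinOn hconvex (∑ τ ∈ Finset.Icc 1 t, g τ) (x 1) (c t)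
      (hxmem t (Finset.mem_Icc.2 ⟨h1, h2⟩)) hmem hmin
    rw [hnorm] at hg
    simp only [ha]
    rw [le_div_iff₀ (mul_pos (hLpos t h1 h2) hmpos), ← hcm]
    simp only [hh, hF]
    linarith
  have hginner : ∀ t, 1 ≤ t → t ≤ T →
      ⟪g t, x t⟫ - ⟪g t, xs (t + 1)⟫ ≤ δ t / (2 * P) * (L t * m) := by
    intro t h1 h2
    have e : δ t / (2 * P) * (L t * m) = ‖g t‖ * ‖x t - xs (t + 1)‖ := by
      rw [hnorm, ← hLdef t (Finset.mem_Icc.2 ⟨h1, h2⟩)]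
      simp only [hm]
      field_simp
    rw [e, ← inner_sub_right]
    exact real_inner_le_norm _ _
  have ha1 : a 1 ≤ δ 1 / (2 * P) := by
    have h1 := hginner 1 le_rfl hT
    simp only [ha]
    rw [div_le_iff₀ (mul_pos hL1pos hmpos)]
    have h2 : 0 ≤ c 1 * ‖xs (1 + 1) - x 1‖ ^ 2 :=
      mul_nonneg (hcpos 1 le_rfl hT).le (sq_nonneg _)
    simp only [hh, hF, Finset.Icc_self, Finset.sum_singleton, sub_self, norm_zero]
    linarith
  have hσ0 : ∀ t, 0 ≤ σ t := fun t => by rw [hσ]; positivity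
  have hσ1 : ∀ t, σ t ≤ 1 := fun t => by rw [hσ]; exact min_le_left _ _
  have hsqT : 1 ≤ Real.sqrt T := Real.one_le_sqrt.2 hTR
  have hσs : ∀ t ∈ Finset.Icc 1 T, (Real.sqrt T)⁻¹ ≤ σ t := by
    intro t ht
    obtain ⟨h1, h2⟩ := Finset.mem_Icc.1 ht
    have ht0 : (0 : ℝ) < t := by exact_mod_cast h1
    have hsq0 := Real.sqrt_pos.2 ht0
    rw [hσ]
    refine le_min (inv_le_one_of_one_le₀ hsqT) ?_
    have : (Real.sqrt T)⁻¹ ≤ (Real.sqrt t)⁻¹ := by gcongr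
    rw [div_eq_mul_inv]
    linarith [inv_pos.2 hsq0]
  have hσsq : ∀ t ∈ Finset.Icc 1 T, σ t ^ 2 ≤ 4 * ((t : ℝ))⁻¹ := by
    intro t ht
    have h2 : σ t ≤ 2 / Real.sqrt t := by rw [hσ]; exact min_le_right _ _
    refine (pow_le_pow_left₀ (hσ0 t) h2 2).trans_eq ?_
    rw [div_pow, Real.sq_sqrt (Nat.cast_nonneg t)]
    ring
  have hrec : ∀ t, 1 ≤ t → t + 1 ≤ T → a (t + 1) ≤ (1 - σ t) * a t + σ t ^ 2 +
      δ (t + 1) / (2 * P) + (Real.log (L (t + 1)) - Real.log (L t)) := by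
    intro t h1 h2
    have htT : t ≤ T := by omega
    have htm : t ∈ Finset.Icc 1 T := Finset.mem_Icc.2 ⟨h1, htT⟩
    have hxt1 := hxmem (t + 1) (Finset.mem_Icc.2 ⟨by omega, h2⟩)
    obtain ⟨hs1, -⟩ := hxsF (t + 1) (by omega) h2
    obtain ⟨hs0, hmin0⟩ := hxsF t h1 htT
    refine normalized_gap_step ((sq_nonneg _).trans (hda t h1 htT)) (hLpos t h1 htT)
      (hstep t h1 h2) hmpos (hσ1 t) ?_
    rw [hah _ (by omega) h2, hah _ h1 htT, ← hcm t]
    obtain ⟨hvm, hvmin⟩ := hv t htm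
    have hcg := conditional_gradient_step (∑ τ ∈ Finset.Icc 1 t, g τ) (x 1)
      (hcpos t h1 htT).le (hσ0 t) (hdiam _ hvm _ (hxmem t htm)) (y := xs (t + 1)) (by
        have := hvmin _ hs0
        rwa [div_eq_mul_inv, hη1] at this)
    rw [← hupd t htm] at hcg
    have hFsucc : ∀ y, F (t + 1) y = F t y + ⟪g (t + 1), y⟫ +
        (c (t + 1) - c t) * ‖y - x 1‖ ^ 2 := by
      intro y
      simp only [hF]
      rw [Finset.sum_Icc_succ_top (by omega), inner_add_left]
      ring
    have hcc : 0 ≤ c (t + 1) - c t := by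
      have e : c (t + 1) - c t = (L (t + 1) - L t) * (2 * P / D) := by
        simp only [hc]
        ring
      rw [e]
      exact mul_nonneg (sub_nonneg.2 (hstep t h1 h2)) (by positivity)
    have hreg : (c (t + 1) - c t) * ‖x (t + 1) - x 1‖ ^ 2 ≤ (L (t + 1) - L t) * m := by
      rw [sub_mul (L (t + 1)), ← hcm, ← hcm, ← sub_mul]
      exact mul_le_mul_of_nonneg_left
        (pow_le_pow_left₀ (norm_nonneg _) (hdiam _ hxt1 _ hx1) 2) hcc
    have hreg' : 0 ≤ (c (t + 1) - c t) * ‖xs (t + 1 + 1) - x 1‖ ^ 2 :=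
      mul_nonneg hcc (sq_nonneg _)
    have hgi := hginner (t + 1) (by omega) h2
    have hmin := hmin0 _ hs1
    have hcg' : F t (x (t + 1)) ≤ (1 - σ t) * F t (x t) + σ t * F t (xs (t + 1)) +
      σ t ^ 2 * (c t * D ^ 2) := hcg
    simp only [hh]
    rw [hFsucc, hFsucc]
    linarith
  obtain ⟨N, rfl⟩ : ∃ N, T = N + 1 := ⟨T - 1, by omega⟩
  have hsum := sum_gap_le (fun t ht => (sq_nonneg _).trans
    (hda t (Finset.mem_Icc.1 ht).1 (Finset.mem_Icc.1 ht).2)) ha1 hσs hσsq hrec N le_rfl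
  set T : ℕ := N + 1
  set q : ℝ := Real.sqrt T
  set S : ℝ := ∑ t ∈ Finset.Icc 1 T, δ t with hS
  set Λ : ℝ := Real.log ((T : ℝ) * Real.exp 1 * L T / L 1) with hΛ
  have hLT : 0 < L T := hLpos T hT le_rfl
  have hΛeq : Λ = Real.log T + 1 + (Real.log (L T) - Real.log (L 1)) := by
    rw [hΛ, Real.log_div (by positivity) hL1pos.ne', Real.log_mul (by positivity) hLT.ne',
      Real.log_mul hT0.ne' (Real.exp_pos 1).ne', Real.log_exp]
    ring
  have hlogL : 0 ≤ Real.log (L T) - Real.log (L 1) :=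
    sub_nonneg.2 (Real.log_le_log hL1pos (hLle 1 le_rfl hT))
  have hΛ1 : 1 ≤ Λ := by linarith [Real.log_nonneg hTR]
  have hharm : ∑ t ∈ Finset.Icc 1 N, ((t : ℝ))⁻¹ ≤ 1 + Real.log T := by
    refine le_trans ?_ (harmonic_le_one_add_log T)
    rw [harmonic_eq_sum_Icc]
    push_cast
    exact Finset.sum_le_sum_of_subset_of_nonneg (Finset.Icc_subset_Icc_right (Nat.le_succ N))
      fun _ _ _ => by positivity
  have hqpos : 0 < q := by linarith
  have hA : q⁻¹ * ∑ t ∈ Finset.Icc 1 T, a t ≤ S / (2 * P) + 4 * Λ := by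
    have haT : q⁻¹ * a T ≤ a T := mul_le_of_le_one_left
      ((sq_nonneg _).trans (hda T hT le_rfl)) (inv_le_one_of_one_le₀ hsqT)
    rw [Finset.sum_Icc_succ_top (by omega : 1 ≤ N + 1), mul_add]
    linarith
  have hCS : S ^ 2 ≤ T * ∑ t ∈ Finset.Icc 1 T, a t := by
    refine (sq_sum_le_card_mul_sum_sq).trans ?_
    rw [Nat.card_Icc, Nat.add_sub_cancel]
    gcongr with t ht
    exact hda t (Finset.mem_Icc.1 ht).1 (Finset.mem_Icc.1 ht).2
  have hSsq : S ^ 2 ≤ 4 * P ^ 2 * Λ + P * S / 2 := by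
    have h1 := mul_le_mul_of_nonneg_left hA (sq_nonneg P)
    have h2 : P ^ 2 * (q⁻¹ * ∑ t ∈ Finset.Icc 1 T, a t) = T * ∑ t ∈ Finset.Icc 1 T, a t := by
      rw [hPsq]
      field_simp
    have h3 : P ^ 2 * (S / (2 * P) + 4 * Λ) = 4 * P ^ 2 * Λ + P * S / 2 := by
      field_simp
      ring
    linarith
  have hSle : S ≤ 12 * P * Real.sqrt Λ := by
    by_contra! hlt
    have hr1 : 1 ≤ Real.sqrt Λ := Real.one_le_sqrt.2 hΛ1
    have hrsq : Real.sqrt Λ ^ 2 = Λ := Real.sq_sqrt (by linarith)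
    have hPr : P ≤ P * Real.sqrt Λ := le_mul_of_one_le_right hPpos.le hr1
    have h1 : P * S ≤ S * S := mul_le_mul_of_nonneg_right (by linarith) (by linarith)
    have h2 : (12 * P * Real.sqrt Λ) ^ 2 < S ^ 2 := pow_lt_pow_left₀ hlt (by positivity) two_ne_zero
    have h3 : (12 * P * Real.sqrt Λ) ^ 2 = 144 * (P ^ 2 * Λ) := by
      rw [mul_pow, mul_pow, hrsq]
      ring
    have h4 : 0 < P ^ 2 * Λ := by positivity
    linarith
  calc ∑ t ∈ Finset.Icc 1 T, L t * ‖x t - xs (t + 1)‖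
      ≤ ∑ t ∈ Finset.Icc 1 T, L T * (δ t * D) := by
        refine Finset.sum_le_sum fun t ht => ?_
        rw [← hnorm]
        exact mul_le_mul_of_nonneg_right
          (hLle t (Finset.mem_Icc.1 ht).1 (Finset.mem_Icc.1 ht).2) (norm_nonneg _)
    _ = L T * D * S := by rw [hS, ← Finset.mul_sum, ← Finset.sum_mul]; ring
    _ ≤ L T * D * (12 * P * Real.sqrt Λ) := by gcongr
    _ = 12 * D * L T * P * Real.sqrt Λ := by ring
end

section
/- Under the adaptive Online Conditional Gradient algorithm, with the auxiliary FTRL sequence x*_t ∈ argmin_{x ∈ 𝒳} F_{t−1}(x) for t = 1, …, T+1, one has Σ_{t=1}^T L_t·‖x*_{t+1} − x*_t‖ ≤ 3 · D · L_T · √T. -/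
open scoped RealInnerProductSpace

section FTRL

variable {E : Type*} [NormedAddCommGroup E] [InnerProductSpace ℝ E]

/-- Quadratic growth around the constrained minimizer of a linear function plus
`a‖y - c‖²`. -/
lemma quadratic_growth_of_forall_le {S : Set E} (hS : Convex ℝ S) {G c p y : E} {a : ℝ}
    (ha : 0 ≤ a) (hp : p ∈ S) (hy : y ∈ S)
    (hmin : ∀ z ∈ S, ⟪G, p⟫ + a * ‖p - c‖ ^ 2 ≤ ⟪G, z⟫ + a * ‖z - c‖ ^ 2) :
    ⟪G, p⟫ + a * ‖p - c‖ ^ 2 + a * ‖y - p‖ ^ 2 ≤ ⟪G, y⟫ + a * ‖y - c‖ ^ 2 := by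
  have expand (s : ℝ) : ⟪G, p + s • (y - p)⟫ + a * ‖p + s • (y - p) - c‖ ^ 2 =
      ⟪G, p⟫ + a * ‖p - c‖ ^ 2 + s * (⟪G, y - p⟫ + 2 * a * ⟪p - c, y - p⟫)
        + s ^ 2 * (a * ‖y - p‖ ^ 2) := by
    rw [show p + s • (y - p) - c = (p - c) + s • (y - p) by abel, norm_add_sq_real,
      inner_add_right, inner_smul_right, inner_smul_right, norm_smul, mul_pow,
      Real.norm_eq_abs, sq_abs]
    ring
  have hone := expand 1
  rw [one_smul, add_sub_cancel] at hone
  rw [hone]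
  set B := ⟪G, y - p⟫ + 2 * a * ⟪p - c, y - p⟫
  set C := a * ‖y - p‖ ^ 2
  have hC : 0 ≤ C := by positivity
  suffices 0 ≤ B by linarith
  by_contra! hB
  have hCB : 0 < C - B := by linarith
  set s := -B / (C - B) with hs
  have hs0 : 0 < s := div_pos (by linarith) hCB
  have hs1 : s ≤ 1 := (div_le_one hCB).2 (by linarith)
  have hle := hmin _ (hS.add_smul_sub_mem hp hy ⟨hs0.le, hs1⟩)
  rw [expand s] at hle
  have hsC : s * (C - B) = -B := div_mul_cancel₀ _ hCB.ne'
  have : s * (B + s * C) = s * (s * B) := by linear_combination s * hsC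
  have := mul_neg_of_pos_of_neg hs0 (mul_neg_of_pos_of_neg hs0 hB)
  nlinarith

/-- Stability of minimizers when the linear part changes by `g` and the regularization weight
grows from `a` to `b`. -/
lemma norm_sub_mul_le_of_forall_le {S : Set E} (hS : Convex ℝ S) {G g c p q : E}
    {a b D : ℝ} (ha : 0 ≤ a) (hab : a ≤ b)
    (hp : p ∈ S) (hq : q ∈ S) (hpD : ‖p - c‖ ≤ D) (hqD : ‖q - c‖ ≤ D)
    (hpmin : ∀ z ∈ S, ⟪G, p⟫ + a * ‖p - c‖ ^ 2 ≤ ⟪G, z⟫ + a * ‖z - c‖ ^ 2)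
    (hqmin : ∀ z ∈ S, ⟪G + g, q⟫ + b * ‖q - c‖ ^ 2 ≤ ⟪G + g, z⟫ + b * ‖z - c‖ ^ 2) :
    (b + a) * ‖q - p‖ ≤ ‖g‖ + 2 * D * (b - a) := by
  have hpq := quadratic_growth_of_forall_le hS ha hp hq hpmin
  have hqp := quadratic_growth_of_forall_le hS (ha.trans hab) hq hp hqmin
  rw [norm_sub_rev p q] at hqp
  simp only [inner_add_left] at hqp
  have hg : ⟪g, p⟫ - ⟪g, q⟫ ≤ ‖g‖ * ‖q - p‖ := by
    rw [← inner_sub_right, norm_sub_rev q p]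
    exact real_inner_le_norm _ _
  have htri : ‖p - c‖ ≤ ‖q - c‖ + ‖q - p‖ := by
    rw [show p - c = (q - c) - (q - p) by abel]
    exact norm_sub_le _ _
  have hsq : ‖p - c‖ ^ 2 - ‖q - c‖ ^ 2 ≤ 2 * D * ‖q - p‖ := by
    nlinarith [norm_nonneg (p - c), norm_nonneg (q - c), norm_nonneg (q - p)]
  have hreg := mul_le_mul_of_nonneg_left hsq (sub_nonneg.2 hab)
  have hD : 0 ≤ D := (norm_nonneg _).trans hpD
  rcases (norm_nonneg (q - p)).eq_or_lt with h | h
  · rw [← h, mul_zero]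
    have := sub_nonneg.2 hab
    positivity
  · refine le_of_mul_le_mul_right ?_ h
    linarith

end FTRL

/-- Summing increments `d t ≤ A * L t + B * (L t - L (t - 1))` along a monotone sequence. -/
lemma sum_Icc_le_of_le_add_sub {T : ℕ} {L d : ℕ → ℝ} {A B : ℝ} (hA : 0 ≤ A)
    (hmono : ∀ t < T, L t ≤ L (t + 1))
    (hd : ∀ t < T, d (t + 1) ≤ A * L (t + 1) + B * (L (t + 1) - L t)) :
    ∑ t ∈ Finset.Icc 1 T, d t ≤ A * T * L T + B * (L T - L 0) := by
  induction T with
  | zero => simp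
  | succ m ih =>
    have h := ih (fun t ht => hmono t (by omega)) (fun t ht => hd t (by omega))
    rw [Finset.sum_Icc_succ_top (by omega)]
    push_cast
    have := mul_le_mul_of_nonneg_left (hmono m (by omega)) (by positivity : 0 ≤ A * m)
    linarith [hd m (by omega)]

/-- **Term (D) bound for adaptive OCG (FTRL stability).**
Under the adaptive Online Conditional Gradient algorithm, with the auxiliary FTRL sequence
`x*_t ∈ argmin_{x ∈ 𝒳} F_{t−1}(x)` for `t = 1, …, T+1`, one has
`Σ_{t=1}^T L_t·‖x*_{t+1} − x*_t‖ ≤ 3·D·L_T·√T`. -/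
theorem adaptive_ocg_termD
    (n T : ℕ) (hT : 1 ≤ T)
    (𝒳 : Set (EuclideanSpace ℝ (Fin n))) (hclosed : IsClosed 𝒳) (hconvex : Convex ℝ 𝒳)
    (D : ℝ) (hD : 0 < D) (hdiam : ∀ x ∈ 𝒳, ∀ y ∈ 𝒳, ‖x - y‖ ≤ D)
    (fhat : ℕ → EuclideanSpace ℝ (Fin n) → ℝ)
    (hfconv : ∀ t ∈ Finset.Icc 1 T, ConvexOn ℝ 𝒳 (fhat t))
    (x v g : ℕ → EuclideanSpace ℝ (Fin n))
    (hx1 : x 1 ∈ 𝒳)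
    (hxmem : ∀ t ∈ Finset.Icc 1 T, x t ∈ 𝒳)
    (hsubgrad : ∀ t ∈ Finset.Icc 1 T, ∀ y ∈ 𝒳, fhat t (x t) + ⟪g t, y - x t⟫ ≤ fhat t y)
    (L : ℕ → ℝ)
    (hLdef : ∀ t ∈ Finset.Icc 1 T, L t = ‖g t‖)
    (hL0 : L 0 = L 1) (hL1pos : 0 < L 1)
    (hLmono : ∀ t ∈ Finset.Icc 1 (T - 1), L t ≤ L (t + 1))
    (hLip : ∀ t ∈ Finset.Icc 1 T, ∀ y ∈ 𝒳, ∀ z ∈ 𝒳, |fhat t y - fhat t z| ≤ L t * ‖y - z‖)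
    (η σ : ℕ → ℝ)
    (hη : ∀ t, η t = D / (2 * L t * (T : ℝ) ^ ((3 : ℝ) / 4)))
    (hσ : ∀ t, σ t = min 1 (2 / Real.sqrt t))
    (hv : ∀ t ∈ Finset.Icc 1 T, v t ∈ 𝒳 ∧ ∀ y ∈ 𝒳,
      ⟪(∑ τ ∈ Finset.Icc 1 t, g τ) + (2 / η t) • (x t - x 1), v t⟫ ≤
      ⟪(∑ τ ∈ Finset.Icc 1 t, g τ) + (2 / η t) • (x t - x 1), y⟫)
    (hupd : ∀ t ∈ Finset.Icc 1 T, x (t + 1) = (1 - σ t) • x t + σ t • v t)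
    -- the auxiliary FTRL sequence: for `t = 1, …, T+1`, `xs t` minimizes
    -- `F_{t-1}(y) = Σ_{τ=1}^{t-1} ⟪g_τ, y⟫ + ‖y − x_1‖²/η_{t-1}` over `𝒳`
    -- (here `L 0 = L 1`, so `η 0 = η 1` and `F_0(y) = ‖y − x_1‖²/η_1`)
    (xs : ℕ → EuclideanSpace ℝ (Fin n))
    (hxs : ∀ t ∈ Finset.Icc 1 (T + 1), xs t ∈ 𝒳 ∧ ∀ y ∈ 𝒳,
      (∑ τ ∈ Finset.Icc 1 (t - 1), ⟪g τ, xs t⟫) + ‖xs t - x 1‖ ^ 2 / η (t - 1) ≤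
      (∑ τ ∈ Finset.Icc 1 (t - 1), ⟪g τ, y⟫) + ‖y - x 1‖ ^ 2 / η (t - 1)) :
    ∑ t ∈ Finset.Icc 1 T, L t * ‖xs (t + 1) - xs t‖ ≤ 3 * D * L T * Real.sqrt T := by
  have hmono : ∀ t < T, L t ≤ L (t + 1) := by
    rintro (_ | t) ht
    · exact hL0.le
    · exact hLmono _ (Finset.mem_Icc.2 ⟨by omega, by omega⟩)
  have hpos : ∀ t ≤ T, 0 < L t := by
    intro t
    induction t with
    | zero => intro _; rwa [hL0]
    | succ m ih => exact fun hm => (ih (by omega)).trans_le (hmono m (by omega))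
  have hT1 : (1 : ℝ) ≤ T := by exact_mod_cast hT
  set P : ℝ := (T : ℝ) ^ ((3 : ℝ) / 4) with hPdef
  have hP : 0 < P := by positivity
  have hdiv (t : ℕ) (r : ℝ) : r / η t = 2 * L t * P / D * r := by
    rw [hη, div_div_eq_mul_div]
    ring
  have hstep : ∀ t < T, L (t + 1) * ‖xs (t + 1 + 1) - xs (t + 1)‖ ≤
      D / (2 * P) * L (t + 1) + 2 * D * (L (t + 1) - L t) := by
    intro t ht
    have hL := hpos t ht.le
    have hL' := hpos (t + 1) ht
    obtain ⟨hp, hpmin⟩ := hxs (t + 1) (Finset.mem_Icc.2 ⟨by omega, by omega⟩)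
    obtain ⟨hq, hqmin⟩ := hxs (t + 1 + 1) (Finset.mem_Icc.2 ⟨by omega, by omega⟩)
    simp only [Nat.add_sub_cancel, hdiv, ← sum_inner] at hpmin hqmin
    rw [Finset.sum_Icc_succ_top (by omega)] at hqmin
    have hab : 2 * L t * P / D ≤ 2 * L (t + 1) * P / D := by
      have := hmono t ht
      gcongr
    have key := norm_sub_mul_le_of_forall_le hconvex (by positivity) hab hp hq
      (hdiam _ hp _ hx1) (hdiam _ hq _ hx1) hpmin hqmin
    rw [← hLdef _ (Finset.mem_Icc.2 ⟨by omega, by omega⟩)] at key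
    set d := ‖xs (t + 1 + 1) - xs (t + 1)‖
    have hd : 0 ≤ d := norm_nonneg _
    have hinc := sub_nonneg.2 (hmono t ht)
    have hdrop : 2 * L (t + 1) * P / D * d ≤
        (2 * L (t + 1) * P / D + 2 * L t * P / D) * d := by
      gcongr
      linarith [show 0 ≤ 2 * L t * P / D by positivity]
    have hscale := mul_le_mul_of_nonneg_left (hdrop.trans key)
      (by positivity : 0 ≤ D / (2 * P))
    calc L (t + 1) * d = D / (2 * P) * (2 * L (t + 1) * P / D * d) := by field_simp
      _ ≤ _ := hscale
      _ = D / (2 * P) * L (t + 1) + 2 * D * (L (t + 1) - L t) := by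
          field_simp
  have hsum := sum_Icc_le_of_le_add_sub
    (d := fun t => L t * ‖xs (t + 1) - xs t‖) (by positivity) hmono hstep
  have hPsqrt : (T : ℝ) ≤ P * √T := by
    rw [hPdef, Real.sqrt_eq_rpow, ← Real.rpow_add (by linarith)]
    exact Real.self_le_rpow_of_one_le hT1 (by norm_num)
  have hsqrt : 1 ≤ √(T : ℝ) := Real.one_le_sqrt.2 hT1
  have hLT := hpos T le_rfl
  have hfirst : D / (2 * P) * T * L T ≤ D * L T * √T := by
    calc D / (2 * P) * T * L T ≤ D / (2 * P) * (P * √T) * L T := by gcongr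
      _ = D * L T * √T / 2 := by field_simp
      _ ≤ D * L T * √T := half_le_self (by positivity)
  have hsecond : 2 * D * (L T - L 0) ≤ 2 * D * L T * √T := by
    calc 2 * D * (L T - L 0) ≤ 2 * D * L T := by
          gcongr
          linarith [hpos 0 (by omega)]
      _ ≤ 2 * D * L T * √T := le_mul_of_one_le_right (by positivity) hsqrt
  linarith
end

section
/- The Follow-the-Regularized-Leader policy with time-varying Euclidean regularizer satisfies, for every sequence of convex cost functions l_1, …, l_T and every feasible point u ∈ 𝒳, the regret bound Σ_{t=1}^T l_t(x_t) − Σ_{t=1}^T l_t(u) ≤ D²/η_T + (1/4)·Σ_{t=1}^T η_{t−1}·‖∇_t‖². -/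
open scoped RealInnerProductSpace

/-- Quadratic growth of a linear function plus `‖y - c‖ ^ 2 / η` around its minimizer over a
convex set. -/
theorem inner_add_sq_dist_growth {E : Type*} [NormedAddCommGroup E] [InnerProductSpace ℝ E]
    {K : Set E} (hK : Convex ℝ K) {a c z y : E} {η : ℝ} (hη : 0 < η) (hz : z ∈ K) (hy : y ∈ K)
    (hmin : ∀ w ∈ K, ⟪a, z⟫ + ‖z - c‖ ^ 2 / η ≤ ⟪a, w⟫ + ‖w - c‖ ^ 2 / η) :
    ⟪a, z⟫ + ‖z - c‖ ^ 2 / η + ‖y - z‖ ^ 2 / η ≤ ⟪a, y⟫ + ‖y - c‖ ^ 2 / η := by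
  set A := ⟪a, y - z⟫ + 2 * ⟪z - c, y - z⟫ / η with hA
  set B := ‖y - z‖ ^ 2 / η with hB
  have hB0 : 0 ≤ B := by positivity
  have expand : ∀ s : ℝ, ⟪a, z + s • (y - z)⟫ + ‖z + s • (y - z) - c‖ ^ 2 / η =
      ⟪a, z⟫ + ‖z - c‖ ^ 2 / η + s * (A + s * B) := by
    intro s
    rw [add_sub_right_comm, norm_add_sq_real, inner_add_right, inner_smul_right,
      inner_smul_right, norm_smul, mul_pow, Real.norm_eq_abs, sq_abs, hA, hB]
    ring
  have hA0 : 0 ≤ A := by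
    by_contra! hneg
    have hBA : 0 < B - A := by linarith
    have hs : 0 < -A / (B - A) := div_pos (by linarith) hBA
    have hs1 : -A / (B - A) ≤ 1 := (div_le_one hBA).2 (by linarith)
    have h := hmin _ (hK.add_smul_sub_mem hz hy ⟨hs.le, hs1⟩)
    rw [expand] at h
    have hlt : A + -A / (B - A) * B < 0 := by
      have : A + -A / (B - A) * B = -(A ^ 2 / (B - A)) := by
        field_simp
        ring
      rw [this]
      exact neg_neg_of_pos (div_pos (sq_pos_of_neg hneg) hBA)
    linarith [mul_neg_of_pos_of_neg hs hlt]
  have h1 := expand 1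
  rw [one_smul, add_sub_cancel] at h1
  linarith

/-- Young's inequality for the inner product, with weight `η`. -/
theorem inner_sub_le_young {E : Type*} [NormedAddCommGroup E] [InnerProductSpace ℝ E]
    {η : ℝ} (hη : 0 < η) (g p q : E) :
    ⟪g, p⟫ - ⟪g, q⟫ ≤ 1 / 4 * (η * ‖g‖ ^ 2) + ‖q - p‖ ^ 2 / η := by
  have h : ⟪g, p⟫ - ⟪g, q⟫ ≤ ‖g‖ * ‖q - p‖ := by
    rw [← inner_sub_right, norm_sub_rev]
    exact real_inner_le_norm _ _
  have h2 : 1 / 4 * (η * ‖g‖ ^ 2) + ‖q - p‖ ^ 2 / η - ‖g‖ * ‖q - p‖ =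
      (η * ‖g‖ / 2 - ‖q - p‖) ^ 2 / η := by
    field_simp
    ring
  have h3 : 0 ≤ (η * ‖g‖ / 2 - ‖q - p‖) ^ 2 / η := by positivity
  linarith

/-- **FTRL with time-varying Euclidean regularizer regret bound.**
The Follow-the-Regularized-Leader policy with time-varying Euclidean regularizer satisfies,
for every sequence of convex cost functions `l_1, …, l_T` and every feasible point `u ∈ 𝒳`,
`Σ_{t=1}^T l_t(x_t) − Σ_{t=1}^T l_t(u) ≤ D²/η_T + (1/4)·Σ_{t=1}^T η_{t−1}·‖∇_t‖²`. -/
theorem ftrl_time_varying_regret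
    (n T : ℕ) (hT : 1 ≤ T)
    (𝒳 : Set (EuclideanSpace ℝ (Fin n))) (hclosed : IsClosed 𝒳) (hconvex : Convex ℝ 𝒳)
    (D : ℝ) (hD : 0 < D) (hdiam : ∀ x ∈ 𝒳, ∀ y ∈ 𝒳, ‖x - y‖ ≤ D)
    (l : ℕ → EuclideanSpace ℝ (Fin n) → ℝ)
    (hlconv : ∀ t ∈ Finset.Icc 1 T, ConvexOn ℝ 𝒳 (l t))
    (η : ℕ → ℝ)
    (hηpos : ∀ t, 0 < η t)
    (hηmono : ∀ t, η (t + 1) ≤ η t)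
    (x g : ℕ → EuclideanSpace ℝ (Fin n))
    (hx1 : x 1 ∈ 𝒳)
    (hxmem : ∀ t ∈ Finset.Icc 1 T, x t ∈ 𝒳)
    -- g t is a subgradient of l_t at x_t
    (hsubgrad : ∀ t ∈ Finset.Icc 1 T, ∀ y ∈ 𝒳, l t (x t) + ⟪g t, y - x t⟫ ≤ l t y)
    -- the FTRL update: `x (t+1)` minimizes `Σ_{τ=1}^t ⟪g_τ, y⟫ + ‖y − x_1‖²/η_t` over `𝒳`
    (hupd : ∀ t ∈ Finset.Icc 1 T, x (t + 1) ∈ 𝒳 ∧ ∀ y ∈ 𝒳,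
      (∑ τ ∈ Finset.Icc 1 t, ⟪g τ, x (t + 1)⟫) + ‖x (t + 1) - x 1‖ ^ 2 / η t ≤
      (∑ τ ∈ Finset.Icc 1 t, ⟪g τ, y⟫) + ‖y - x 1‖ ^ 2 / η t) :
    ∀ u ∈ 𝒳,
      (∑ t ∈ Finset.Icc 1 T, l t (x t)) - ∑ t ∈ Finset.Icc 1 T, l t u ≤
        D ^ 2 / η T + (1 / 4) * ∑ t ∈ Finset.Icc 1 T, η (t - 1) * ‖g t‖ ^ 2 := by
  intro u hu
  have key : ∀ t ≤ T, ∀ y ∈ 𝒳,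
      (∑ τ ∈ Finset.Icc 1 t, ⟪g τ, x τ⟫) + ‖y - x (t + 1)‖ ^ 2 / η t ≤
        (∑ τ ∈ Finset.Icc 1 t, ⟪g τ, y⟫) + ‖y - x 1‖ ^ 2 / η t +
          1 / 4 * ∑ τ ∈ Finset.Icc 1 t, η (τ - 1) * ‖g τ‖ ^ 2 := by
    intro t
    induction t with
    | zero => simp
    | succ t ih =>
      intro ht y hy
      obtain ⟨hz, hmin⟩ := hupd (t + 1) (Finset.mem_Icc.2 ⟨by omega, ht⟩)
      have growth := inner_add_sq_dist_growth hconvex (a := ∑ τ ∈ Finset.Icc 1 (t + 1), g τ)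
        (hηpos (t + 1)) hz hy (by simpa only [sum_inner] using hmin)
      have prev := ih (by omega) _ hz
      have young := inner_sub_le_young (hηpos t) (g (t + 1)) (x (t + 1)) (x (t + 1 + 1))
      have mono : ‖x (t + 1 + 1) - x 1‖ ^ 2 / η t ≤ ‖x (t + 1 + 1) - x 1‖ ^ 2 / η (t + 1) :=
        div_le_div_of_nonneg_left (sq_nonneg _) (hηpos _) (hηmono t)
      simp only [sum_inner] at growth
      simp only [Finset.sum_Icc_succ_top (Nat.le_add_left 1 t), Nat.add_sub_cancel] at growth ⊢
      linarith
  have hlin : (∑ t ∈ Finset.Icc 1 T, l t (x t)) - ∑ t ∈ Finset.Icc 1 T, l t u ≤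
      (∑ t ∈ Finset.Icc 1 T, ⟪g t, x t⟫) - ∑ t ∈ Finset.Icc 1 T, ⟪g t, u⟫ := by
    rw [← Finset.sum_sub_distrib, ← Finset.sum_sub_distrib]
    refine Finset.sum_le_sum fun t ht => ?_
    have h := hsubgrad t ht u hu
    rw [inner_sub_right] at h
    linarith
  have hT' := key T le_rfl u hu
  have hpos : 0 ≤ ‖u - x (T + 1)‖ ^ 2 / η T := div_nonneg (sq_nonneg _) (hηpos T).le
  have hD' : ‖u - x 1‖ ^ 2 / η T ≤ D ^ 2 / η T :=
    div_le_div_of_nonneg_right (pow_le_pow_left₀ (norm_nonneg _) (hdiam u hu _ hx1) 2)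
      (hηpos T).le
  linarith
end

section
/- Regret decomposition inequality: for every x* ∈ 𝒳 satisfying g_t(x*) ≤ 0 for all t = 1, …, T, it holds that Φ(Q(T)) + V·Σ_{t=1}^T (f_t(x_t) − f_t(x*)) ≤ Φ(Q(0)) + Σ_{t=1}^T (f̂_t(x_t) − f̂_t(x*)). -/
/-- The left-sided tangent inequality for a convex function on a set of reals. -/
theorem ConvexOn.sub_le_mul_sub_of_hasDerivWithinAt {s : Set ℝ} {φ : ℝ → ℝ} {φ' a b : ℝ}
    (hφ : ConvexOn ℝ s φ) (ha : a ∈ s) (hb : b ∈ s) (hab : a ≤ b)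
    (hφ' : HasDerivWithinAt φ φ' s b) : φ b - φ a ≤ φ' * (b - a) := by
  rcases hab.eq_or_lt with rfl | hlt
  · simp
  · have h := hφ.slope_le_of_hasDerivWithinAt ha hb hlt hφ'
    rwa [slope_def_field, div_le_iff₀ (sub_pos.2 hlt)] at h

/-- **Regret decomposition inequality.**
For every `x* ∈ 𝒳` satisfying `g_t(x*) ≤ 0` for all `t = 1, …, T`, it holds that
`Φ(Q(T)) + V·Σ_{t=1}^T (f_t(x_t) − f_t(x*)) ≤ Φ(Q(0)) + Σ_{t=1}^T (f̂_t(x_t) − f̂_t(x*))`. -/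
theorem regret_decomposition
    (n T : ℕ) (hT : 1 ≤ T)
    (𝒳 : Set (EuclideanSpace ℝ (Fin n))) (hconvex : Convex ℝ 𝒳)
    (f g : ℕ → EuclideanSpace ℝ (Fin n) → ℝ)
    (hfconv : ∀ t ∈ Finset.Icc 1 T, ConvexOn ℝ 𝒳 (f t))
    (hgconv : ∀ t ∈ Finset.Icc 1 T, ConvexOn ℝ 𝒳 (g t))
    (Φ Φ' : ℝ → ℝ)
    (hΦconv : ConvexOn ℝ (Set.Ici (0 : ℝ)) Φ)
    (hΦmono : MonotoneOn Φ (Set.Ici (0 : ℝ)))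
    (hΦnonneg : ∀ q ∈ Set.Ici (0 : ℝ), 0 ≤ Φ q)
    (hΦderiv : ∀ q ∈ Set.Ici (0 : ℝ), HasDerivWithinAt Φ (Φ' q) (Set.Ici (0 : ℝ)) q)
    (V : ℝ) (hV : 0 ≤ V)
    (x : ℕ → EuclideanSpace ℝ (Fin n))
    (hxmem : ∀ t ∈ Finset.Icc 1 T, x t ∈ 𝒳)
    (Q : ℕ → ℝ) (hQ0 : 0 ≤ Q 0)
    (hQ : ∀ t ∈ Finset.Icc 1 T, Q t = Q (t - 1) + max 0 (g t (x t)))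
    (fhat : ℕ → EuclideanSpace ℝ (Fin n) → ℝ)
    (hfhat : ∀ t ∈ Finset.Icc 1 T, ∀ y ∈ 𝒳,
      fhat t y = V * f t y + Φ' (Q t) * max 0 (g t y)) :
    ∀ xstar ∈ 𝒳, (∀ t ∈ Finset.Icc 1 T, g t xstar ≤ 0) →
      Φ (Q T) + V * ∑ t ∈ Finset.Icc 1 T, (f t (x t) - f t xstar) ≤
        Φ (Q 0) + ∑ t ∈ Finset.Icc 1 T, (fhat t (x t) - fhat t xstar) := by
  intro xstar hxstar hgstar
  have key : ∀ m ≤ T, 0 ≤ Q m ∧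
      Φ (Q m) + V * ∑ t ∈ Finset.Icc 1 m, (f t (x t) - f t xstar) ≤
        Φ (Q 0) + ∑ t ∈ Finset.Icc 1 m, (fhat t (x t) - fhat t xstar) := by
    intro m
    induction m with
    | zero => simpa using hQ0
    | succ m ih =>
      intro hm
      obtain ⟨hQm, hsum⟩ := ih (by omega)
      have ht : m + 1 ∈ Finset.Icc 1 T := Finset.mem_Icc.2 ⟨by omega, hm⟩
      have hstep := hQ _ ht
      rw [Nat.add_sub_cancel] at hstep
      have hle : Q m ≤ Q (m + 1) := by
        rw [hstep]
        exact le_add_of_nonneg_right (le_max_left _ _)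
      have hQm' : 0 ≤ Q (m + 1) := hQm.trans hle
      have htan := hΦconv.sub_le_mul_sub_of_hasDerivWithinAt hQm hQm' hle (hΦderiv _ hQm')
      rw [show Q (m + 1) - Q m = max 0 (g (m + 1) (x (m + 1))) by linarith] at htan
      refine ⟨hQm', ?_⟩
      rw [Finset.sum_Icc_succ_top (by omega), Finset.sum_Icc_succ_top (by omega),
        hfhat _ ht _ (hxmem _ ht), hfhat _ ht _ hxstar, max_eq_left (hgstar _ ht)]
      linarith
  exact (key T le_rfl).2
end

section
/- With Φ(x) = x^m, m = log T, Q(0) = G·D·log T, and for any V > 0, the Lipschitz constants L_t = G·(V + m·Q(t)^{m−1}) of the surrogate cost functions satisfy max_{1 ≤ t ≤ T} (L_t/L_{t−1}) ≤ 1 + e. -/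
/-- Increasing `q ≥ c * m` by at most `c` multiplies `q ^ (m - 1)` by at most `e`. -/
theorem rpow_sub_one_le_exp_one_mul {m c q r : ℝ} (hm : 1 ≤ m) (hc : 0 < c)
    (hq : c * m ≤ q) (hr : 0 ≤ r) (hrq : r ≤ q + c) :
    r ^ (m - 1) ≤ Real.exp 1 * q ^ (m - 1) := by
  have hm0 : 0 < m := by linarith
  have hq0 : 0 < q := (mul_pos hc hm0).trans_le hq
  have hcq : c ≤ q * (1 / m) := by
    rw [mul_one_div, le_div_iff₀ hm0]
    exact hq
  have hrexp : r ≤ Real.exp (1 / m) * q := by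
    nlinarith [Real.add_one_le_exp (1 / m)]
  calc r ^ (m - 1) ≤ (Real.exp (1 / m) * q) ^ (m - 1) :=
        Real.rpow_le_rpow hr hrexp (by linarith)
    _ = Real.exp (1 / m * (m - 1)) * q ^ (m - 1) := by
        rw [Real.mul_rpow (Real.exp_pos _).le hq0.le, ← Real.exp_mul]
    _ ≤ Real.exp 1 * q ^ (m - 1) := by
        have : 1 / m * (m - 1) ≤ 1 := by
          rw [one_div_mul_eq_div, div_le_one hm0]
          linarith
        gcongr


/-- **Ratio of successive Lipschitz constants is bounded.**
With `Φ(x) = x^m`, `m = log T`, `Q(0) = G·D·log T`, and for any `V > 0`, the Lipschitz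
constants `L_t = G·(V + m·Q(t)^{m−1})` of the surrogate cost functions satisfy
`max_{1 ≤ t ≤ T} (L_t/L_{t−1}) ≤ 1 + e`. -/
theorem lipschitz_ratio_bound
    (T : ℕ) (hT1 : 1 ≤ T) (hT : Real.exp 2 ≤ (T : ℝ))
    (m : ℝ) (hm : m = Real.log T)
    (G D V : ℝ) (hG : 0 < G) (hD : 0 < D) (hV : 0 < V)
    (Q : ℕ → ℝ)
    (hQ0 : Q 0 = G * D * Real.log T)
    (hQmono : ∀ t ∈ Finset.Icc 1 T, Q (t - 1) ≤ Q t)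
    (hQstep : ∀ t ∈ Finset.Icc 1 T, Q t - Q (t - 1) ≤ G * D)
    (L : ℕ → ℝ)
    (hL : ∀ t, t ≤ T → L t = G * (V + m * Q t ^ (m - 1))) :
    ((Finset.Icc 1 T).sup' (Finset.nonempty_Icc.mpr hT1) fun t => L t / L (t - 1)) ≤
      1 + Real.exp 1 := by
  have hm1 : 1 ≤ m := by
    have h := Real.log_le_log (Real.exp_pos 2) hT
    rw [Real.log_exp] at h
    linarith
  have hm0 : 0 < m := by linarith
  have hGD : 0 < G * D := mul_pos hG hD
  have hQlower : ∀ t, t ≤ T → G * D * m ≤ Q t := by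
    intro t
    induction t with
    | zero => intro _; rw [hQ0, hm]
    | succ k ih =>
      intro hk
      exact (ih (by omega)).trans (hQmono (k + 1) (Finset.mem_Icc.mpr ⟨by omega, hk⟩))
  refine Finset.sup'_le _ _ fun t ht => ?_
  have htT : t ≤ T := (Finset.mem_Icc.mp ht).2
  have hprev : t - 1 ≤ T := by omega
  have hQt : 0 ≤ Q t := (mul_pos hGD hm0).le.trans (hQlower t htT)
  have hQprev : 0 < Q (t - 1) := (mul_pos hGD hm0).trans_le (hQlower _ hprev)
  have hpow := rpow_sub_one_le_exp_one_mul hm1 hGD (hQlower _ hprev) hQt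
    (by linarith [hQstep t ht])
  have hpos : 0 < Q (t - 1) ^ (m - 1) := Real.rpow_pos_of_pos hQprev _
  have hexp : 1 ≤ Real.exp 1 := Real.one_le_exp zero_le_one
  have hLe : V + m * Q t ^ (m - 1) ≤ Real.exp 1 * (V + m * Q (t - 1) ^ (m - 1)) := by
    nlinarith [mul_le_mul_of_nonneg_left hpow hm0.le, mul_le_mul_of_nonneg_right hexp hV.le]
  have hden : 0 < V + m * Q (t - 1) ^ (m - 1) := by positivity
  rw [hL t htT, hL _ hprev, mul_div_mul_left _ _ hG.ne']
  exact ((div_le_iff₀ hden).mpr hLe).trans (by linarith)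
end

section
/- With Φ(x) = x^m, m = log T, Q(0) = G·D·log T, and for any V > 0, the Lipschitz constants L_t = G·(V + m·Q(t)^{m−1}) of the surrogate cost functions satisfy √(log(L_T/L_1)) ≤ log T. -/
/-- A sequence whose increments on `{2, …, T}` are at most `c` grows at most linearly from its value
at `1`. -/
theorem le_add_mul_of_increment_le {T : ℕ} {c : ℝ} {Q : ℕ → ℝ}
    (hstep : ∀ t ∈ Finset.Icc 1 T, Q t - Q (t - 1) ≤ c) {n : ℕ} (hn : 1 ≤ n) (hnT : n ≤ T) :
    Q n ≤ Q 1 + ((n : ℝ) - 1) * c := by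
  induction n, hn using Nat.le_induction with
  | base => simp
  | succ k hk ih =>
    have h := hstep (k + 1) (Finset.mem_Icc.2 ⟨by lia, hnT⟩)
    have ih' := ih (by lia)
    rw [Nat.add_sub_cancel] at h
    push_cast
    linarith

/-- If `0 ≤ y ≤ c * x` with `1 ≤ c`, then `V + m * y ^ p` is at most `c ^ p` times
`V + m * x ^ p`. -/
theorem add_mul_rpow_le_rpow_mul {V m p c x y : ℝ} (hV : 0 ≤ V) (hm : 0 ≤ m) (hp : 0 ≤ p)
    (hc : 1 ≤ c) (hx : 0 ≤ x) (hy : 0 ≤ y) (hyx : y ≤ c * x) :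
    V + m * y ^ p ≤ c ^ p * (V + m * x ^ p) := by
  have hpow : y ^ p ≤ c ^ p * x ^ p := by
    rw [← Real.mul_rpow (by linarith) hx]
    exact Real.rpow_le_rpow hy hyx hp
  have h1 : V ≤ c ^ p * V := le_mul_of_one_le_left hV (Real.one_le_rpow hc hp)
  have h2 := mul_le_mul_of_nonneg_left hpow hm
  linarith


/-- **Bound on `√(log(L_T/L_1))`.**
With `Φ(x) = x^m`, `m = log T`, `Q(0) = G·D·log T`, and for any `V > 0`, the Lipschitz
constants `L_t = G·(V + m·Q(t)^{m−1})` of the surrogate cost functions satisfy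
`√(log(L_T/L_1)) ≤ log T`. -/
theorem sqrt_log_ratio_bound
    (T : ℕ) (hT1 : 1 ≤ T) (hT : Real.exp 2 ≤ (T : ℝ))
    (m : ℝ) (hm : m = Real.log T)
    (G D V : ℝ) (hG : 0 < G) (hD : 0 < D) (hV : 0 < V)
    (Q : ℕ → ℝ)
    (hQ0 : Q 0 = G * D * Real.log T)
    (hQmono : ∀ t ∈ Finset.Icc 1 T, Q (t - 1) ≤ Q t)
    (hQstep : ∀ t ∈ Finset.Icc 1 T, Q t - Q (t - 1) ≤ G * D)
    (L : ℕ → ℝ)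
    (hL : ∀ t, t ≤ T → L t = G * (V + m * Q t ^ (m - 1))) :
    Real.sqrt (Real.log (L T / L 1)) ≤ Real.log T := by
  have hTpos : (0 : ℝ) < T := (Real.exp_pos 2).trans_le hT
  have hT1' : (1 : ℝ) ≤ T := by exact_mod_cast hT1
  have hm2 : 2 ≤ m := hm ▸ (Real.le_log_iff_exp_le hTpos).2 hT
  have hGD : 0 < G * D := mul_pos hG hD
  have hQ1 : G * D ≤ Q 1 := by
    have h := hQmono 1 (Finset.mem_Icc.2 ⟨le_rfl, hT1⟩)
    rw [Nat.sub_self, hQ0, ← hm] at h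
    nlinarith
  have hQ1T : Q 1 ≤ Q T := by
    refine Nat.le_induction (P := fun n _ => n ≤ T → Q 1 ≤ Q n) (fun _ => le_rfl) ?_ T hT1 le_rfl
    intro k _ ih hkT
    exact (ih (by lia)).trans (hQmono (k + 1) (Finset.mem_Icc.2 ⟨by lia, hkT⟩))
  have hQT : Q T ≤ T * Q 1 := by
    have h := le_add_mul_of_increment_le hQstep hT1 le_rfl
    nlinarith
  have hQ1pos : 0 < Q 1 := hGD.trans_le hQ1
  have hQTpos : 0 < Q T := hQ1pos.trans_le hQ1T
  have hmpos : 0 < m := by linarith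
  have hratio : L T / L 1 ≤ (T : ℝ) ^ (m - 1) := by
    rw [hL T le_rfl, hL 1 hT1, mul_div_mul_left _ _ hG.ne', div_le_iff₀ (by positivity)]
    exact add_mul_rpow_le_rpow_mul hV.le hmpos.le (by linarith) hT1' hQ1pos.le hQTpos.le hQT
  have hpos : 0 < L T / L 1 := by
    rw [hL T le_rfl, hL 1 hT1]
    positivity
  have hlog := Real.log_le_log hpos hratio
  rw [Real.log_rpow hTpos, ← hm] at hlog
  rw [← hm, Real.sqrt_le_iff]
  exact ⟨hmpos.le, by nlinarith⟩
end

section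
/- Cumulative constraint violation bound: suppose real numbers Q ≥ 0 and R satisfy R ≥ −G·D·T and the master inequality Q^m + V·R ≤ (G·D·m)^m + c·m·T^{3/4}·(V + m·Q^{m−1}). Then Q ≤ max( (4·c·V·T)^{1/m} + 2·G·D·m , 2·c·m²·T^{3/4} ). -/
/-- **Cumulative constraint violation bound from the master inequality.**
Suppose real numbers `Q ≥ 0` and `R` satisfy `R ≥ −G·D·T` and the master inequality
`Q^m + V·R ≤ (G·D·m)^m + c·m·T^{3/4}·(V + m·Q^{m−1})`. Then
`Q ≤ max( (4·c·V·T)^{1/m} + 2·G·D·m , 2·c·m²·T^{3/4} )`. -/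
theorem ccv_bound_from_master_inequality
    (T m G D V c Q R : ℝ)
    (hT : 1 ≤ T) (hm : 1 ≤ m) (hmT : m ≤ T ^ ((1 : ℝ) / 4))
    (hG : 0 < G) (hD : 0 < D) (hV : 0 < V) (hc : G * D ≤ c)
    (hQ : 0 ≤ Q) (hR : -(G * D * T) ≤ R)
    (hmaster : Q ^ m + V * R ≤
      (G * D * m) ^ m + c * m * T ^ ((3 : ℝ) / 4) * (V + m * Q ^ (m - 1))) :
    Q ≤ max ((4 * c * V * T) ^ (1 / m) + 2 * G * D * m)
          (2 * c * m ^ 2 * T ^ ((3 : ℝ) / 4)) := by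
  by_contra! h
  obtain ⟨h1, h2⟩ := max_lt_iff.mp h
  have hm0 : 0 < m := by linarith
  have hT0 : 0 < T := by linarith
  have hGD : 0 < G * D := mul_pos hG hD
  have hc0 : 0 < c := lt_of_lt_of_le hGD hc
  have hQ0 : 0 < Q := lt_of_le_of_lt (by positivity) h2
  have hS : 0 < T ^ ((3 : ℝ) / 4) := by positivity
  have hmS : m * T ^ ((3 : ℝ) / 4) ≤ T := by
    calc m * T ^ ((3 : ℝ) / 4) ≤ T ^ ((1 : ℝ) / 4) * T ^ ((3 : ℝ) / 4) := by gcongr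
      _ = T := by rw [← Real.rpow_add hT0]; norm_num
  have hQm : Q ^ m = Q * Q ^ (m - 1) := by
    rw [Real.rpow_sub_one hQ0.ne']; field_simp
  have hbulk : 2 * c * m ^ 2 * T ^ ((3 : ℝ) / 4) * Q ^ (m - 1) ≤ Q ^ m := by
    rw [hQm]; gcongr
  have hlin : c * V * (m * T ^ ((3 : ℝ) / 4)) ≤ c * V * T := by gcongr
  have hVR : -(c * V * T) ≤ V * R := by
    have h3 : G * D * (V * T) ≤ c * (V * T) := by gcongr
    have h4 : V * -(G * D * T) ≤ V * R := by gcongr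
    linarith
  have hupper : Q ^ m ≤ 2 * (G * D * m) ^ m + 4 * c * V * T := by linarith
  have hpow : ((4 * c * V * T) ^ (1 / m) + 2 * G * D * m) ^ m < Q ^ m :=
    Real.rpow_lt_rpow (by positivity) h1 hm0
  have hsuper := Real.add_rpow_le_rpow_add (p := m) (a := (4 * c * V * T) ^ (1 / m))
    (b := 2 * G * D * m) (by positivity) (by positivity) hm
  have hroot : ((4 * c * V * T) ^ (1 / m)) ^ m = 4 * c * V * T := by
    rw [one_div, Real.rpow_inv_rpow (by positivity) hm0.ne']
  have htwo : 2 * (G * D * m) ^ m ≤ (2 * G * D * m) ^ m := by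
    have h5 : (2 : ℝ) ≤ 2 ^ m := Real.self_le_rpow_of_one_le (by norm_num) hm
    rw [show 2 * G * D * m = 2 * (G * D * m) by ring,
      Real.mul_rpow (x := 2) (y := G * D * m) (by norm_num) (by positivity)]
    gcongr
  linarith
end

section
/- Regret bound from the master inequality: suppose real numbers Q ≥ 0 and R satisfy Q^m + V·R ≤ (G·D·m)^m + c·m·T^{3/4}·(V + m·Q^{m−1}). Then R ≤ c·m·T^{3/4} + (G·D·m)^m/V + (c·m²·T^{3/4})^m/V. -/
/-- For `m ≥ 1`, the product `A * Q ^ (m - 1)` is at most `Q ^ m + A ^ m`. -/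
theorem mul_rpow_sub_one_le_rpow_add_rpow {A Q m : ℝ} (hA : 0 < A) (hQ : 0 ≤ Q) (hm : 1 ≤ m) :
    A * Q ^ (m - 1) ≤ Q ^ m + A ^ m := by
  have mul_rpow_sub_one {x : ℝ} (hx : 0 < x) : x * x ^ (m - 1) = x ^ m := by
    rw [Real.rpow_sub_one hx.ne', mul_div_cancel₀ _ hx.ne']
  rcases le_total Q A with h | h
  · calc A * Q ^ (m - 1) ≤ A * A ^ (m - 1) := by
          gcongr
      _ = A ^ m := mul_rpow_sub_one hA
      _ ≤ Q ^ m + A ^ m := le_add_of_nonneg_left (Real.rpow_nonneg hQ m)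
  · calc A * Q ^ (m - 1) ≤ Q * Q ^ (m - 1) := by gcongr
      _ = Q ^ m := mul_rpow_sub_one (hA.trans_le h)
      _ ≤ Q ^ m + A ^ m := le_add_of_nonneg_right (Real.rpow_nonneg hA.le m)

/-- **Regret bound from the master inequality.**
Suppose real numbers `Q ≥ 0` and `R` satisfy the master inequality
`Q^m + V·R ≤ (G·D·m)^m + c·m·T^{3/4}·(V + m·Q^{m−1})`. Then
`R ≤ c·m·T^{3/4} + (G·D·m)^m/V + (c·m²·T^{3/4})^m/V`. -/
theorem regret_bound_from_master_inequality
    (T m G D V c Q R : ℝ)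
    (hT : 1 ≤ T) (hm : 1 ≤ m)
    (hG : 0 < G) (hD : 0 < D) (hV : 0 < V) (hc : 0 < c)
    (hQ : 0 ≤ Q)
    (hmaster : Q ^ m + V * R ≤
      (G * D * m) ^ m + c * m * T ^ ((3 : ℝ) / 4) * (V + m * Q ^ (m - 1))) :
    R ≤ c * m * T ^ ((3 : ℝ) / 4) + (G * D * m) ^ m / V +
      (c * m ^ 2 * T ^ ((3 : ℝ) / 4)) ^ m / V := by
  have hA : 0 < c * m ^ 2 * T ^ ((3 : ℝ) / 4) := by positivity
  have key := mul_rpow_sub_one_le_rpow_add_rpow hA hQ hm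
  rw [add_assoc, ← add_div, ← sub_le_iff_le_add', le_div_iff₀ hV]
  linarith
end

section
/- Summation of the OCG error recursion: if nonnegative reals u_1, …, u_T satisfy u_{t+1} ≤ (1 − (2/3)·σ_t)·u_t + (15/8)·D²·σ_t² + (3/2)·D²·(1 − L_t/L_{t+1}) for all t = 1, …, T−1, where σ_t = min(1, 2/√t), then (2/3)·σ_T·Σ_{t=1}^T u_t ≤ u_1 + (15/2)·D²·(1 + ln T) + (3/2)·D²·ln(L_T/L_1). -/
/-- **Summation of the OCG error recursion.**
If nonnegative reals `u_1, …, u_T` satisfy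
`u_{t+1} ≤ (1 − (2/3)·σ_t)·u_t + (15/8)·D²·σ_t² + (3/2)·D²·(1 − L_t/L_{t+1})`
for all `t = 1, …, T−1`, where `σ_t = min(1, 2/√t)`, then
`(2/3)·σ_T·Σ_{t=1}^T u_t ≤ u_1 + (15/2)·D²·(1 + ln T) + (3/2)·D²·ln(L_T/L_1)`. -/
theorem ocg_error_recursion_sum
    (T : ℕ) (hT : 1 ≤ T)
    (D : ℝ) (hD : 0 < D)
    (L : ℕ → ℝ) (hL1pos : 0 < L 1)
    (hLmono : ∀ t ∈ Finset.Icc 1 (T - 1), L t ≤ L (t + 1))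
    (σ : ℕ → ℝ) (hσ : ∀ t, σ t = min 1 (2 / Real.sqrt t))
    (u : ℕ → ℝ)
    (hu : ∀ t ∈ Finset.Icc 1 T, 0 ≤ u t)
    (hrec : ∀ t ∈ Finset.Icc 1 (T - 1),
      u (t + 1) ≤ (1 - (2 / 3) * σ t) * u t + (15 / 8) * D ^ 2 * σ t ^ 2 +
        (3 / 2) * D ^ 2 * (1 - L t / L (t + 1))) :
    (2 / 3) * σ T * ∑ t ∈ Finset.Icc 1 T, u t ≤
      u 1 + (15 / 2) * D ^ 2 * (1 + Real.log T) + (3 / 2) * D ^ 2 * Real.log (L T / L 1) := by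
  have hσT_le_one : σ T ≤ 1 := by rw [hσ]; exact min_le_left _ _
  have main : ∀ n, 1 ≤ n → n ≤ T → 0 < L n ∧
      (2 / 3) * σ T * ∑ t ∈ Finset.Icc 1 n, u t + (1 - (2 / 3) * σ T) * u n ≤
        u 1 + (15 / 2) * D ^ 2 * (1 + Real.log n - 1 / n) +
          (3 / 2) * D ^ 2 * Real.log (L n / L 1) := by
    intro n hn
    induction n, hn using Nat.le_induction with
    | base =>
      intro _
      refine ⟨hL1pos, ?_⟩
      simp only [Finset.Icc_self, Finset.sum_singleton, Nat.cast_one, Real.log_one,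
        div_self hL1pos.ne']
      linarith
    | succ n hn ih =>
      intro hnT
      obtain ⟨hLn, ih⟩ := ih (by omega)
      have hmem : n ∈ Finset.Icc 1 (T - 1) := Finset.mem_Icc.mpr ⟨hn, by omega⟩
      have hLn' : 0 < L (n + 1) := hLn.trans_le (hLmono n hmem)
      refine ⟨hLn', ?_⟩
      have hn0 : (0 : ℝ) < n := by exact_mod_cast hn
      have hun : 0 ≤ u n := hu n (Finset.mem_Icc.mpr ⟨hn, by omega⟩)
      have hσ_anti : σ T ≤ σ n := by
        rw [hσ, hσ]
        have hcast : (n : ℝ) ≤ T := by exact_mod_cast (by omega : n ≤ T)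
        gcongr
      have hσ_sq : σ n ^ 2 ≤ 4 / n := by
        have h0 : 0 ≤ σ n := by rw [hσ]; positivity
        have h1 : σ n ≤ 2 / √(n : ℝ) := by rw [hσ]; exact min_le_right _ _
        calc σ n ^ 2 ≤ (2 / √(n : ℝ)) ^ 2 := by gcongr
          _ = 4 / (n : ℝ) := by rw [div_pow, Real.sq_sqrt hn0.le]; norm_num
      have hlogn : 1 / ((n + 1 : ℕ) : ℝ) ≤ Real.log (n + 1 : ℕ) - Real.log n := by
        rw [← Real.log_div (by positivity) hn0.ne']
        refine le_trans (le_of_eq ?_) (Real.one_sub_inv_le_log_of_pos (by positivity))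
        push_cast
        field_simp
        ring
      have hlogL : 1 - L n / L (n + 1) ≤ Real.log (L (n + 1) / L 1) - Real.log (L n / L 1) := by
        rw [Real.log_div hLn'.ne' hL1pos.ne', Real.log_div hLn.ne' hL1pos.ne', sub_sub_sub_cancel_right,
          ← Real.log_div hLn'.ne' hLn.ne', ← inv_div (L (n + 1)) (L n)]
        exact Real.one_sub_inv_le_log_of_pos (by positivity)
      have hD2 : 0 < D ^ 2 := by positivity
      have h1 := mul_le_mul_of_nonneg_left hσ_sq hD2.le
      have h2 := mul_le_mul_of_nonneg_left hlogn hD2.le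
      have h3 := mul_le_mul_of_nonneg_left hlogL hD2.le
      have h4 := mul_le_mul_of_nonneg_right hσ_anti hun
      have h5 := hrec n hmem
      rw [Finset.sum_Icc_succ_top (by omega)]
      have h6 : D ^ 2 * (4 / n) = 4 * (D ^ 2 * (1 / n)) := by ring
      linarith
  obtain ⟨-, h⟩ := main T hT le_rfl
  have huT : 0 ≤ (1 - (2 / 3) * σ T) * u T :=
    mul_nonneg (by linarith) (hu T (Finset.mem_Icc.mpr ⟨hT, le_rfl⟩))
  have hT0 : 0 ≤ (15 / 2) * D ^ 2 * (1 / (T : ℝ)) := by positivity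
  linarith
end

section
/- Stability of FTRL with time-varying Euclidean regularizer: for every t ≥ 1, the successive minimizers x*_t ∈ argmin_{x ∈ 𝒳} F_{t−1}(x) and x*_{t+1} ∈ argmin_{x ∈ 𝒳} F_t(x) satisfy ‖x*_t − x*_{t+1}‖ ≤ 2·( η_t·‖∇_t‖ + D·√(1 − η_t/η_{t−1}) ). -/
open scoped RealInnerProductSpace

/-- Quadratic growth at a constrained minimizer of a linear function plus a squared distance. -/
theorem IsMinOn.add_norm_sq_div_le {E : Type*} [NormedAddCommGroup E] [InnerProductSpace ℝ E]
    {s : Set E} (hs : Convex ℝ s) {v c a y : E} {η : ℝ} (hη : 0 < η) (ha : a ∈ s) (hy : y ∈ s)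
    (hmin : IsMinOn (fun x => ⟪v, x⟫ + ‖x - c‖ ^ 2 / η) s a) :
    ⟪v, a⟫ + ‖a - c‖ ^ 2 / η + ‖y - a‖ ^ 2 / η ≤ ⟪v, y⟫ + ‖y - c‖ ^ 2 / η := by
  set A := ⟪v, a⟫ + ‖a - c‖ ^ 2 / η with hA
  set Y := ⟪v, y⟫ + ‖y - c‖ ^ 2 / η with hY
  have hsegment : ∀ θ : ℝ, 0 < θ → θ ≤ 1 → (1 - θ) * (‖y - a‖ ^ 2 / η) ≤ Y - A := by
    intro θ hθ hθ1
    have hmem : a + θ • (y - a) ∈ s := hs.add_smul_sub_mem ha hy ⟨hθ.le, hθ1⟩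
    have hle : A ≤ ⟪v, a + θ • (y - a)⟫ + ‖a + θ • (y - a) - c‖ ^ 2 / η := hmin hmem
    have hinner : ⟪v, a + θ • (y - a)⟫ = ⟪v, a⟫ + θ * (⟪v, y⟫ - ⟪v, a⟫) := by
      rw [inner_add_right, inner_smul_right, inner_sub_right]
    have hnorm : ‖a + θ • (y - a) - c‖ ^ 2 =
        ‖a - c‖ ^ 2 + 2 * θ * ⟪a - c, y - a⟫ + θ ^ 2 * ‖y - a‖ ^ 2 := by
      rw [add_sub_right_comm, norm_add_sq_real, inner_smul_right, norm_smul, mul_pow,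
        Real.norm_eq_abs, sq_abs]
      ring
    have hnorm' : ‖y - c‖ ^ 2 = ‖a - c‖ ^ 2 + 2 * ⟪a - c, y - a⟫ + ‖y - a‖ ^ 2 := by
      rw [← norm_add_sq_real, sub_add_sub_comm, add_comm a y, add_sub_add_right_eq_sub]
    have hcombine : ⟪v, a + θ • (y - a)⟫ + ‖a + θ • (y - a) - c‖ ^ 2 / η =
        A + θ * (Y - A - (1 - θ) * (‖y - a‖ ^ 2 / η)) := by
      rw [hA, hY, hinner, hnorm, hnorm']
      ring
    rw [hcombine, le_add_iff_nonneg_right] at hle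
    linarith [nonneg_of_mul_nonneg_right hle hθ]
  have hK : 0 ≤ ‖y - a‖ ^ 2 / η := by positivity
  suffices ‖y - a‖ ^ 2 / η ≤ Y - A by linarith
  refine le_of_forall_pos_le_add fun ε hε => ?_
  set K := ‖y - a‖ ^ 2 / η
  have h := hsegment (ε / (K + ε)) (by positivity) ((div_le_one (by positivity)).2 (by linarith))
  have hε' : ε / (K + ε) * K ≤ ε := by
    rw [div_mul_eq_mul_div, div_le_iff₀ (by positivity)]
    nlinarith
  linarith

/-- **Stability of FTRL with time-varying Euclidean regularizer.**
For every `t ≥ 1`, the successive minimizers `x*_t ∈ argmin_{x ∈ 𝒳} F_{t−1}(x)` and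
`x*_{t+1} ∈ argmin_{x ∈ 𝒳} F_t(x)` satisfy
`‖x*_t − x*_{t+1}‖ ≤ 2·(η_t·‖∇_t‖ + D·√(1 − η_t/η_{t−1}))`. -/
theorem ftrl_stability
    (n : ℕ)
    (𝒳 : Set (EuclideanSpace ℝ (Fin n))) (hclosed : IsClosed 𝒳) (hconvex : Convex ℝ 𝒳)
    (D : ℝ) (hD : 0 < D) (hdiam : ∀ x ∈ 𝒳, ∀ y ∈ 𝒳, ‖x - y‖ ≤ D)
    (x₁ : EuclideanSpace ℝ (Fin n)) (hx₁ : x₁ ∈ 𝒳)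
    (g : ℕ → EuclideanSpace ℝ (Fin n))
    (η : ℕ → ℝ) (hηpos : ∀ t, 0 < η t) (hηmono : ∀ t, η (t + 1) ≤ η t)
    (F : ℕ → EuclideanSpace ℝ (Fin n) → ℝ)
    (hF : ∀ t, ∀ y : EuclideanSpace ℝ (Fin n),
      F t y = (∑ τ ∈ Finset.Icc 1 t, ⟪g τ, y⟫) + ‖y - x₁‖ ^ 2 / η t) :
    ∀ t : ℕ, 1 ≤ t →
      ∀ a ∈ 𝒳, ∀ b ∈ 𝒳,
        (∀ y ∈ 𝒳, F (t - 1) a ≤ F (t - 1) y) →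
        (∀ y ∈ 𝒳, F t b ≤ F t y) →
        ‖a - b‖ ≤ 2 * (η t * ‖g t‖ + D * Real.sqrt (1 - η t / η (t - 1))) := by
  intro t ht a ha b hb hamin hbmin
  obtain ⟨t, rfl⟩ := Nat.exists_eq_add_of_le' ht
  rw [Nat.add_sub_cancel] at hamin ⊢
  have hFv : ∀ u y, F u y = ⟪∑ τ ∈ Finset.Icc 1 u, g τ, y⟫ + ‖y - x₁‖ ^ 2 / η u := by
    intro u y
    rw [hF, sum_inner]
  have hgrowth : ∀ u, ∀ x ∈ 𝒳, ∀ y ∈ 𝒳, (∀ z ∈ 𝒳, F u x ≤ F u z) →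
      F u x + ‖y - x‖ ^ 2 / η u ≤ F u y := by
    intro u x hx y hy hmin
    simp only [hFv] at hmin ⊢
    exact IsMinOn.add_norm_sq_div_le hconvex (hηpos u) hx hy (isMinOn_iff.2 hmin)
  have hagrowth := hgrowth t a ha b hb hamin
  have hbgrowth := hgrowth (t + 1) b hb a ha hbmin
  have hp := hηpos t
  have hq := hηpos (t + 1)
  have hratio : 0 ≤ 1 - η (t + 1) / η t := sub_nonneg.2 ((div_le_one hp).2 (hηmono t))
  simp only [hF, Finset.sum_Icc_succ_top (Nat.le_add_left 1 t)] at hagrowth hbgrowth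
  have hinner : ⟪g (t + 1), a⟫ - ⟪g (t + 1), b⟫ ≤ ‖g (t + 1)‖ * ‖a - b‖ := by
    rw [← inner_sub_right]
    exact real_inner_le_norm _ _
  have hsq : ‖a - x₁‖ ^ 2 ≤ D ^ 2 := by
    gcongr
    exact hdiam a ha x₁ hx₁
  have hdrop : 0 ≤ ‖b - a‖ ^ 2 / η t := by positivity
  have hsum : ‖a - b‖ ^ 2 / η (t + 1) ≤ ‖g (t + 1)‖ * ‖a - b‖ +
      (‖a - x₁‖ ^ 2 - ‖b - x₁‖ ^ 2) / η (t + 1) - (‖a - x₁‖ ^ 2 - ‖b - x₁‖ ^ 2) / η t := by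
    simp only [sub_div]
    linarith
  have hscaled : ‖a - b‖ ^ 2 ≤ η (t + 1) * ‖g (t + 1)‖ * ‖a - b‖ +
      (1 - η (t + 1) / η t) * (‖a - x₁‖ ^ 2 - ‖b - x₁‖ ^ 2) := by
    have h := mul_le_mul_of_nonneg_left hsum hq.le
    field_simp at h ⊢
    linarith
  set r := D * √(1 - η (t + 1) / η t) with hr
  have hr0 : 0 ≤ r := by positivity
  have hc0 : 0 ≤ η (t + 1) * ‖g (t + 1)‖ := by positivity
  have hr2 : r ^ 2 = (1 - η (t + 1) / η t) * D ^ 2 := by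
    rw [hr, mul_pow, Real.sq_sqrt hratio, mul_comm]
  have hquad : ‖a - b‖ ^ 2 ≤ η (t + 1) * ‖g (t + 1)‖ * ‖a - b‖ + r ^ 2 := by
    rw [hr2]
    refine hscaled.trans ?_
    gcongr
    linarith [sq_nonneg ‖b - x₁‖]
  have hbound : ‖a - b‖ ≤ η (t + 1) * ‖g (t + 1)‖ + r := by
    by_contra! hlt
    nlinarith
  linarith
end

section
/- Per-iteration decrease of Frank–Wolfe with exact line search: for any z ∈ 𝒳, let v ∈ argmin_{y ∈ 𝒳} ⟨∇F(z), y⟩, d = ⟨∇F(z), z − v⟩, let σ* ∈ argmin_{σ ∈ [0,1]} F(z + σ·(v − z)), and set z⁺ = z + σ*·(v − z). Then F(z⁺) − F(x*) ≤ (F(z) − F(x*)) − min{ (d/(4R))², d/2 }. -/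
open scoped RealInnerProductSpace

/-- **Descent lemma.** A function whose gradient is `L`-Lipschitz is bounded above by its
first-order expansion plus the quadratic `L / 2 * ‖w‖ ^ 2`. -/
theorem le_add_inner_add_of_gradient_lipschitz {E : Type*} [NormedAddCommGroup E]
    [InnerProductSpace ℝ E] [CompleteSpace E] {F : E → ℝ} {F' : E → E} {L : ℝ}
    (hF : ∀ y, HasGradientAt F (F' y) y)
    (hL : ∀ y z, ‖F' y - F' z‖ ≤ L * ‖y - z‖) (x w : E) :
    F (x + w) ≤ F x + inner ℝ (F' x) w + L / 2 * ‖w‖ ^ 2 := by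
  let g : ℝ → ℝ := fun t => F (x + t • w) - t * inner ℝ (F' x) w - L / 2 * ‖w‖ ^ 2 * t ^ 2
  have hg (t : ℝ) : HasDerivAt g
      (inner ℝ (F' (x + t • w)) w - inner ℝ (F' x) w - L * ‖w‖ ^ 2 * t) t := by
    have hline : HasDerivAt (fun t : ℝ => x + t • w) w t := by
      simpa using ((hasDerivAt_id t).smul_const w).const_add x
    have hcomp : HasDerivAt (fun t : ℝ => F (x + t • w)) (inner ℝ (F' (x + t • w)) w) t := by
      exact ((hF (x + t • w)).hasFDerivAt.comp_hasDerivAt t hline).congr_deriv (by simp)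
    refine ((hcomp.sub ((hasDerivAt_id t).mul_const (inner ℝ (F' x) w))).sub
      ((hasDerivAt_pow 2 t).const_mul (L / 2 * ‖w‖ ^ 2))).congr_deriv ?_
    norm_num
    ring
  have hanti : AntitoneOn g (Set.Ici 0) := by
    refine antitoneOn_of_deriv_nonpos (convex_Ici 0)
      (fun t _ => (hg t).continuousAt.continuousWithinAt)
      (fun t _ => (hg t).differentiableAt.differentiableWithinAt) fun t ht => ?_
    rw [interior_Ici, Set.mem_Ioi] at ht
    rw [(hg t).deriv, ← inner_sub_left]
    have hlip := hL (x + t • w) x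
    rw [add_sub_cancel_left, norm_smul, Real.norm_of_nonneg ht.le] at hlip
    have hinner := real_inner_le_norm (F' (x + t • w) - F' x) w
    have hmul := mul_le_mul_of_nonneg_right hlip (norm_nonneg w)
    linarith
  have h := hanti (Set.mem_Ici.2 le_rfl) (Set.mem_Ici.2 zero_le_one) zero_le_one
  simp only [g, one_smul, zero_smul, add_zero] at h
  linarith

/-- **Per-iteration decrease of Frank–Wolfe with exact line search.**
For any `z ∈ 𝒳`, let `v ∈ argmin_{y ∈ 𝒳} ⟪∇F(z), y⟫`, `d = ⟪∇F(z), z − v⟫`, let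
`σ* ∈ argmin_{σ ∈ [0,1]} F(z + σ·(v − z))`, and set `z⁺ = z + σ*·(v − z)`. Then
`F(z⁺) − F(x*) ≤ (F(z) − F(x*)) − min{ (d/(4R))², d/2 }`. -/
theorem frank_wolfe_line_search_decrease
    (n : ℕ) (R : ℝ) (hR : 0 < R)
    (𝒳 : Set (EuclideanSpace ℝ (Fin n))) (hcompact : IsCompact 𝒳) (hconvex : Convex ℝ 𝒳)
    (hball : ∀ y ∈ 𝒳, ‖y‖ ≤ R)
    (F : EuclideanSpace ℝ (Fin n) → ℝ) (F' : EuclideanSpace ℝ (Fin n) → EuclideanSpace ℝ (Fin n))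
    (hFconv : ConvexOn ℝ Set.univ F)
    (hFgrad : ∀ y, HasGradientAt F (F' y) y)
    (hsmooth : ∀ y z, ‖F' y - F' z‖ ≤ 2 * ‖y - z‖)
    (xstar : EuclideanSpace ℝ (Fin n)) (hxstar : xstar ∈ 𝒳)
    (hxstarmin : ∀ y ∈ 𝒳, F xstar ≤ F y)
    (z v : EuclideanSpace ℝ (Fin n)) (hz : z ∈ 𝒳) (hv : v ∈ 𝒳)
    (hvmin : ∀ y ∈ 𝒳, ⟪F' z, v⟫ ≤ ⟪F' z, y⟫)
    (d : ℝ) (hd : d = ⟪F' z, z - v⟫)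
    (σstar : ℝ) (hσ0 : 0 ≤ σstar) (hσ1 : σstar ≤ 1)
    (hσmin : ∀ σ : ℝ, 0 ≤ σ → σ ≤ 1 →
      F (z + σstar • (v - z)) ≤ F (z + σ • (v - z))) :
    F (z + σstar • (v - z)) - F xstar ≤
      (F z - F xstar) - min ((d / (4 * R)) ^ 2) (d / 2) := by
  have hw : ‖v - z‖ ≤ 2 * R := by
    linarith [norm_sub_le v z, hball v hv, hball z hz]
  have hw2 : ‖v - z‖ ^ 2 ≤ 4 * R ^ 2 := by
    nlinarith [norm_nonneg (v - z)]
  have hd0 : 0 ≤ d := by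
    rw [hd, inner_sub_right]
    linarith [hvmin z hz]
  have hdir : ⟪F' z, v - z⟫ = -d := by
    rw [hd, ← inner_neg_right, neg_sub]
  have hstep (σ : ℝ) (h0 : 0 ≤ σ) (h1 : σ ≤ 1) :
      F (z + σstar • (v - z)) ≤ F z - σ * d + 4 * R ^ 2 * σ ^ 2 := by
    have hdesc := le_add_inner_add_of_gradient_lipschitz hFgrad hsmooth z (σ • (v - z))
    rw [inner_smul_right, hdir, norm_smul, mul_pow, Real.norm_of_nonneg h0] at hdesc
    have hquad := mul_le_mul_of_nonneg_left hw2 (sq_nonneg σ)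
    linarith [hσmin σ h0 h1]
  rcases le_total d (8 * R ^ 2) with h | h
  · have hs := hstep (d / (8 * R ^ 2)) (by positivity) (div_le_one_of_le₀ h (by positivity))
    have hval : d / (8 * R ^ 2) * d - 4 * R ^ 2 * (d / (8 * R ^ 2)) ^ 2 = (d / (4 * R)) ^ 2 := by
      field_simp
      ring
    linarith [min_le_left ((d / (4 * R)) ^ 2) (d / 2)]
  · linarith [hstep 1 zero_le_one le_rfl, min_le_right ((d / (4 * R)) ^ 2) (d / 2)]
end
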